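/- arXiv:2004.00869 — 15 statements merged into one kernel-verified Lean document; each statement's English description precedes it below -/
import Mathlib

section
/- Let 𝒴 be a finite set, w : 𝒴 → ℝ a probability vector (w(y) ≥ 0, Σ_y w(y) = 1) and p : 𝒴 → [0,1], specifying a joint distribution of a binary random variable X and a random variable Y. For every natural number L ≥ 2 there exist a finite set 𝒵 with |𝒵| = L, a stochastic kernel Q : 𝒴 → 𝒵 (Q(z|y) ≥ 0 and Σ_{z∈𝒵} Q(z|y) = 1 for every y ∈ 𝒴) and r : 𝒵 → [0,1] such that p(y) = Σ_{z∈𝒵} Q(z|y)·r(z) for every y ∈ 𝒴, and Σ_{y∈𝒴} w(y)·h₂(p(y)) − Σ_{z∈𝒵} (Σ_{y∈𝒴} w(y)·Q(z|y))·h₂(r(z)) ≤ 128/L². (Equivalently: there exists a random variable Z on an alphabet of size L such that X−Z−Y form a Markov chain in this order, the joint law of (X,Y) is preserved, and I(X;Z) − I(X;Y) ≤ 128·L⁻².) -/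
open Finset

/-- The binary entropy function `h₂(t) = -t·log t - (1-t)·log(1-t)` (natural log,
convention `0·log 0 = 0`). -/
noncomputable def h2 (t : ℝ) : ℝ := Real.negMulLog t + Real.negMulLog (1 - t)

open Real in
/-- A `χ²`-type lower bound for `negMulLog` in terms of its tangent data at `t`. -/
lemma negMulLog_ge_sub {a t : ℝ} (ha : 0 ≤ a) (ht : 0 < t) :
    -(a * log t) - a * (a / t - 1) ≤ negMulLog a := by
  rcases ha.eq_or_lt with rfl | ha
  · simp
  · have h := log_le_sub_one_of_pos (div_pos ha ht)
    rw [log_div ha.ne' ht.ne'] at h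
    have := mul_le_mul_of_nonneg_left h ha.le
    rw [negMulLog]
    linarith

lemma h2_nonneg {t : ℝ} (h0 : 0 ≤ t) (h1 : t ≤ 1) : 0 ≤ h2 t :=
  add_nonneg (Real.negMulLog_nonneg h0 h1)
    (Real.negMulLog_nonneg (by linarith) (by linarith))

open Real in
lemma h2_ge_sub {a t : ℝ} (ha0 : 0 ≤ a) (ha1 : a ≤ 1) (ht0 : 0 < t) (ht1 : t < 1) :
    -(a * log t) - (1 - a) * log (1 - t) - (a - t) ^ 2 / (t * (1 - t)) ≤ h2 a := by
  have h1 := negMulLog_ge_sub ha0 ht0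
  have h2' := negMulLog_ge_sub (sub_nonneg.2 ha1) (sub_pos.2 ht1)
  have e : (a - t) ^ 2 / (t * (1 - t))
      = a * (a / t - 1) + (1 - a) * ((1 - a) / (1 - t) - 1) := by
    have := (sub_pos.2 ht1).ne'
    field_simp
    ring
  rw [h2, e]
  linarith

/-- If `t` is split into `a` and `b`, the loss of `h2` is at most
`(t - a) * (b - t) / (t * (1 - t))`. -/
lemma exists_two_point_split {a b t c : ℝ} (ha : 0 ≤ a) (hat : a ≤ t) (htb : t ≤ b) (hb : b ≤ 1)
    (hc : 0 ≤ c) (h : (t - a) * (b - t) ≤ c * (t * (1 - t))) :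
    ∃ l m : ℝ, 0 ≤ l ∧ 0 ≤ m ∧ l + m = 1 ∧ l * a + m * b = t ∧
      h2 t - (l * h2 a + m * h2 b) ≤ c := by
  rcases (hat.trans htb).eq_or_lt with rfl | hab
  · obtain rfl : a = t := le_antisymm hat htb
    exact ⟨1, 0, by simp, by simp, by simp, by simp, by simpa using hc⟩
  have hd : 0 < b - a := sub_pos.2 hab
  obtain ⟨l, m, hl, hm, hlm, hmean⟩ :
      ∃ l m : ℝ, 0 ≤ l ∧ 0 ≤ m ∧ l + m = 1 ∧ l * a + m * b = t := by
    refine ⟨(b - t) / (b - a), (t - a) / (b - a), div_nonneg (by linarith) hd.le,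
      div_nonneg (by linarith) hd.le, ?_, ?_⟩ <;> field_simp <;> ring
  refine ⟨l, m, hl, hm, hlm, hmean, ?_⟩
  have hla := mul_nonneg hl (h2_nonneg ha (by linarith))
  have hmb := mul_nonneg hm (h2_nonneg (by linarith) hb)
  rcases (ha.trans hat).eq_or_lt with h0 | h0
  · have : h2 t = 0 := by simp [h2, ← h0]
    linarith
  rcases (htb.trans hb).eq_or_lt with h1 | h1
  · have : h2 t = 0 := by simp [h2, h1]
    linarith
  have hA := mul_le_mul_of_nonneg_left (h2_ge_sub ha (by linarith) h0 h1) hl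
  have hB := mul_le_mul_of_nonneg_left (h2_ge_sub (by linarith) hb h0 h1) hm
  have hpos : 0 < t * (1 - t) := mul_pos h0 (by linarith)
  have hvar : l * ((a - t) ^ 2 / (t * (1 - t))) + m * ((b - t) ^ 2 / (t * (1 - t))) ≤ c := by
    rw [mul_div_assoc', mul_div_assoc', ← add_div, div_le_iff₀ hpos]
    refine le_trans (le_of_eq ?_) h
    obtain rfl : m = 1 - l := by linarith
    subst hmean
    ring
  have e : h2 t = -(t * Real.log t) - (1 - t) * Real.log (1 - t) := by
    simp only [h2, Real.negMulLog]; ring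
  have e' : l * (-(a * Real.log t) - (1 - a) * Real.log (1 - t))
      + m * (-(b * Real.log t) - (1 - b) * Real.log (1 - t)) = h2 t := by
    rw [e]
    obtain rfl : m = 1 - l := by linarith
    subst hmean
    ring
  linarith

/-- The cubic reparametrization of `[0,1]` that concentrates grid points near `0` and `1`. -/
def smoothGrid (x : ℝ) : ℝ := x ^ 2 * (3 - 2 * x)

lemma smoothGrid_nonneg {x : ℝ} (h1 : x ≤ 1) : 0 ≤ smoothGrid x :=
  mul_nonneg (sq_nonneg x) (by linarith)

lemma one_sub_smoothGrid (x : ℝ) : 1 - smoothGrid x = (1 - x) ^ 2 * (1 + 2 * x) := by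
  unfold smoothGrid; ring

lemma smoothGrid_le_one {x : ℝ} (h0 : 0 ≤ x) : smoothGrid x ≤ 1 := by
  have : 0 ≤ (1 - x) ^ 2 * (1 + 2 * x) := by positivity
  linarith [one_sub_smoothGrid x]

lemma smoothGrid_cell_interior {u d t : ℝ} (hd : 0 < d) (hu : d ≤ u) (hv : d ≤ 1 - (u + d))
    (hat : smoothGrid u ≤ t) (htb : t ≤ smoothGrid (u + d)) :
    (t - smoothGrid u) * (smoothGrid (u + d) - t) ≤ 32 * d ^ 2 * (t * (1 - t)) := by
  obtain ⟨s, hs⟩ : ∃ s, s = 1 - (u + d) := ⟨_, rfl⟩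
  have hsum : u = 1 - s - d := by linarith
  rw [← hs] at hv
  have hP : 0 < u * s := mul_pos (by linarith) (by linarith)
  have hdiff : smoothGrid (u + d) - smoothGrid u
      = d * (3 * (u * (s + d)) + 3 * ((u + d) * s) + d ^ 2) := by
    subst hsum; unfold smoothGrid; ring
  have hdu : u * d ≤ u * s := mul_le_mul_of_nonneg_left hv (by linarith)
  have hds : d * s ≤ u * s := mul_le_mul_of_nonneg_right hu (by linarith)
  have hdd : d ^ 2 ≤ u * s := by nlinarith
  have hlen : smoothGrid (u + d) - smoothGrid u ≤ 13 * d * (u * s) := by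
    rw [hdiff]; nlinarith
  have hlo : 3 * (u * s) ^ 2 ≤ smoothGrid u * (1 - smoothGrid (u + d)) := by
    have e : smoothGrid u * (1 - smoothGrid (u + d))
        = (u * s) ^ 2 * ((3 - 2 * u) * (3 - 2 * s)) := by
      rw [one_sub_smoothGrid, smoothGrid, ← hs, show u + d = 1 - s by linarith]; ring
    rw [e]
    nlinarith [mul_le_mul_of_nonneg_left (show (3 : ℝ) ≤ (3 - 2 * u) * (3 - 2 * s) by nlinarith)
      (sq_nonneg (u * s))]
  have ha : 0 ≤ smoothGrid u := smoothGrid_nonneg (by linarith)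
  have hb : smoothGrid (u + d) ≤ 1 := smoothGrid_le_one (by linarith)
  have ht : smoothGrid u * (1 - smoothGrid (u + d)) ≤ t * (1 - t) :=
    mul_le_mul hat (by linarith) (by linarith) (by linarith)
  have hsq : (smoothGrid (u + d) - smoothGrid u) ^ 2 ≤ (13 * d * (u * s)) ^ 2 :=
    pow_le_pow_left₀ (by linarith) hlen 2
  have hamgm : (t - smoothGrid u) * (smoothGrid (u + d) - t)
      ≤ (smoothGrid (u + d) - smoothGrid u) ^ 2 / 4 := by
    nlinarith [sq_nonneg ((t - smoothGrid u) - (smoothGrid (u + d) - t))]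
  have hfin := mul_le_mul_of_nonneg_left (hlo.trans ht) (sq_nonneg d)
  nlinarith [mul_nonneg (sq_nonneg d) (sq_nonneg (u * s))]

/-- Every cell of the grid `smoothGrid (k / N)` splits its points with loss at most `32 / N ^ 2`. -/
lemma smoothGrid_cell {N k : ℕ} (hk : k < N) {t : ℝ} (h0 : 0 ≤ t) (h1 : t ≤ 1)
    (hat : smoothGrid (k / N) ≤ t) (htb : t ≤ smoothGrid ((k + 1 : ℕ) / N)) :
    (t - smoothGrid (k / N)) * (smoothGrid ((k + 1 : ℕ) / N) - t)
      ≤ 32 / (N : ℝ) ^ 2 * (t * (1 - t)) := by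
  have hN : (0 : ℝ) < N := by exact_mod_cast (Nat.zero_le k).trans_lt hk
  obtain ⟨d, hd⟩ : ∃ d : ℝ, d = 1 / N := ⟨_, rfl⟩
  have hdpos : 0 < d := by rw [hd]; positivity
  have hNd : N * d = 1 := by rw [hd]; field_simp
  have hc : 32 / (N : ℝ) ^ 2 = 32 * d ^ 2 := by rw [hd]; field_simp
  have hu : (k : ℝ) / N = k * d := by rw [hd]; ring
  have hv : ((k + 1 : ℕ) : ℝ) / N = k * d + d := by rw [hd]; push_cast; ring
  rw [hu] at hat ⊢
  rw [hv] at htb ⊢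
  rw [hc]
  have ht : 0 ≤ t * (1 - t) := mul_nonneg h0 (by linarith)
  rcases Nat.eq_zero_or_pos k with rfl | hkpos
  · have hb : smoothGrid d ≤ 3 * d ^ 2 := by
      unfold smoothGrid; nlinarith [mul_pos hdpos (sq_pos_of_pos hdpos)]
    have e : smoothGrid 0 = 0 := by simp [smoothGrid]
    simp only [Nat.cast_zero, zero_mul, zero_add, e, sub_zero] at *
    have hd1 : smoothGrid d ≤ 1 := smoothGrid_le_one hdpos.le
    have : smoothGrid d - t ≤ smoothGrid d * (1 - t) := by nlinarith
    nlinarith [mul_le_mul_of_nonneg_left this h0, mul_le_mul_of_nonneg_right hb ht,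
      mul_nonneg (sq_nonneg d) ht]
  rcases Nat.lt_or_ge (k + 1) N with hkN | hkN
  · refine smoothGrid_cell_interior hdpos ?_ ?_ hat htb
    · have : (1 : ℝ) ≤ k := by exact_mod_cast hkpos
      nlinarith
    · have : (k : ℝ) + 2 ≤ N := by exact_mod_cast hkN
      nlinarith
  · have hkN' : (k : ℝ) + 1 = N := by exact_mod_cast le_antisymm hk hkN
    have hend : (k : ℝ) * d + d = 1 := by rw [← hNd, ← hkN']; ring
    have ha : 1 - smoothGrid (k * d) ≤ 3 * d ^ 2 := by
      rw [one_sub_smoothGrid, show (k : ℝ) * d = 1 - d by linarith]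
      nlinarith [mul_pos hdpos (sq_pos_of_pos hdpos)]
    have ha0 : 0 ≤ smoothGrid (k * d) := smoothGrid_nonneg (by linarith)
    have e : smoothGrid 1 = 1 := by norm_num [smoothGrid]
    rw [hend, e]
    have : t - smoothGrid (k * d) ≤ t * (1 - smoothGrid (k * d)) := by nlinarith
    nlinarith [mul_le_mul_of_nonneg_right this (sub_nonneg.2 h1),
      mul_le_mul_of_nonneg_left ha ht, mul_nonneg (sq_nonneg d) ht]

lemma exists_cell (f : ℕ → ℝ) {t : ℝ} (h0 : f 0 ≤ t) {N : ℕ} (hN : 0 < N) (h1 : t ≤ f N) :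
    ∃ k < N, f k ≤ t ∧ t ≤ f (k + 1) := by
  induction N, hN using Nat.le_induction with
  | base => exact ⟨0, by simp, h0, h1⟩
  | succ n hn ih =>
    rcases le_total t (f n) with h | h
    · obtain ⟨k, hk, hk'⟩ := ih h
      exact ⟨k, by omega, hk'⟩
    · exact ⟨n, by omega, h, h1⟩

/-- Every `t ∈ [0,1]` is the mean of a distribution on the grid with small entropy loss. -/
lemma exists_grid_distribution {N : ℕ} (hN : 0 < N) {t : ℝ} (h0 : 0 ≤ t) (h1 : t ≤ 1) :
    ∃ q : Fin (N + 1) → ℝ, (∀ z, 0 ≤ q z) ∧ ∑ z, q z = 1 ∧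
      t = ∑ z, q z * smoothGrid ((z : ℕ) / N) ∧
      h2 t - ∑ z, q z * h2 (smoothGrid ((z : ℕ) / N)) ≤ 32 / (N : ℝ) ^ 2 := by
  have hN' : (0 : ℝ) < N := by exact_mod_cast hN
  obtain ⟨k, hk, hat, htb⟩ := exists_cell (fun k => smoothGrid (k / N)) (t := t)
    (by simpa [smoothGrid] using h0) hN (by rw [div_self hN'.ne']; norm_num [smoothGrid, h1])
  have hk1 : ((k : ℝ)) / N ≤ 1 := (div_le_one hN').2 (by exact_mod_cast hk.le)
  obtain ⟨l, m, hl, hm, hlm, hmean, hgap⟩ := exists_two_point_split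
    (smoothGrid_nonneg hk1) hat htb (smoothGrid_le_one (by positivity)) (by positivity)
    (smoothGrid_cell hk h0 h1 hat htb)
  let i : Fin (N + 1) := ⟨k, by omega⟩
  let j : Fin (N + 1) := ⟨k + 1, by omega⟩
  have hsum (g : Fin (N + 1) → ℝ) :
      ∑ z, ((if z = i then l else 0) + (if z = j then m else 0)) * g z = l * g i + m * g j := by
    simp [add_mul, sum_add_distrib]
  refine ⟨fun z => (if z = i then l else 0) + (if z = j then m else 0), fun z => ?_, ?_, ?_, ?_⟩
  · exact add_nonneg (by split_ifs <;> simp [hl]) (by split_ifs <;> simp [hm])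
  · simpa [hlm] using hsum fun _ => 1
  · rw [hsum fun z => smoothGrid ((z : ℕ) / N)]
    exact hmean.symm
  · rw [hsum fun z => h2 (smoothGrid ((z : ℕ) / N))]
    exact hgap

/-- Binary greedy-split upgrading: for any joint distribution of a binary `X` and a
finite `Y` (given by the law `w` of `Y` and posteriors `p y = ℙ(X=0|Y=y)`) and any
`L ≥ 2`, there is an upgraded channel with output alphabet of size `L` whose loss in
conditional entropy is at most `128/L²`. -/
theorem binary_upgrading {Y : Type*} [Fintype Y] (w p : Y → ℝ)
    (hw0 : ∀ y, 0 ≤ w y) (hw1 : ∑ y, w y = 1)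
    (hp : ∀ y, 0 ≤ p y ∧ p y ≤ 1)
    (L : ℕ) (hL : 2 ≤ L) :
    ∃ (Q : Y → Fin L → ℝ) (r : Fin L → ℝ),
      (∀ y z, 0 ≤ Q y z) ∧ (∀ y, ∑ z, Q y z = 1) ∧
      (∀ z, 0 ≤ r z ∧ r z ≤ 1) ∧
      (∀ y, p y = ∑ z, Q y z * r z) ∧
      (∑ y, w y * h2 (p y)) - (∑ z, (∑ y, w y * Q y z) * h2 (r z)) ≤ 128 / (L : ℝ) ^ 2 := by
  obtain ⟨N, rfl⟩ : ∃ N, L = N + 1 := ⟨L - 1, by omega⟩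
  have hN : 0 < N := by omega
  have hN1 : (1 : ℝ) ≤ N := by exact_mod_cast hN
  choose Q hQ0 hQ1 hQp hQh using fun y => exists_grid_distribution hN (hp y).1 (hp y).2
  refine ⟨Q, fun z => smoothGrid ((z : ℕ) / N), hQ0, hQ1, fun z => ⟨smoothGrid_nonneg ?_,
    smoothGrid_le_one (by positivity)⟩, hQp, ?_⟩
  · exact (div_le_one (by linarith)).2 (by exact_mod_cast Nat.lt_succ_iff.1 z.2)
  have hswap : ∑ z, (∑ y, w y * Q y z) * h2 (smoothGrid ((z : ℕ) / N))
      = ∑ y, w y * ∑ z, Q y z * h2 (smoothGrid ((z : ℕ) / N)) := by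
    simp_rw [sum_mul, mul_sum, mul_assoc]
    exact sum_comm
  calc _ = ∑ y, w y * (h2 (p y) - ∑ z, Q y z * h2 (smoothGrid ((z : ℕ) / N))) := by
        rw [hswap, ← sum_sub_distrib]
        simp_rw [mul_sub]
    _ ≤ ∑ y, w y * (32 / (N : ℝ) ^ 2) :=
        sum_le_sum fun y _ => mul_le_mul_of_nonneg_left (hQh y) (hw0 y)
    _ = 32 / (N : ℝ) ^ 2 := by rw [← sum_mul, hw1, one_mul]
    _ ≤ 128 / ((N + 1 : ℕ) : ℝ) ^ 2 := by
        rw [div_le_div_iff₀ (by positivity) (by positivity)]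
        push_cast
        nlinarith
end

section
/- Let 𝒳 be a finite set with |𝒳| = q ≥ 2, let 𝒴 be a finite set, and let P : 𝒳 × 𝒴 → ℝ be a joint probability mass function (P(x,y) ≥ 0, Σ_{x,y} P(x,y) = 1) with marginal P_Y(y) = Σ_x P(x,y). Let L be a natural number with L ≥ 2^{q−1} and set Λ = ⌊L^{1/(q−1)}⌋ (so Λ ≥ 2). Then there exist a finite set 𝒵 with |𝒵| ≤ L, a stochastic kernel Q : 𝒴 → 𝒵 and a stochastic kernel R : 𝒵 → 𝒳 such that P(x,y) = P_Y(y)·Σ_{z∈𝒵} Q(z|y)·R(x|z) for all x ∈ 𝒳 and y ∈ 𝒴 (so X−Z−Y forms a Markov chain whose (X,Y)-marginal is P), and Σ_{y} P_Y(y)·H(P_{X|Y=y}) − Σ_{z} P_Z(z)·H(R(·|z)) ≤ 128·(q−1)·Λ⁻², where P_Z(z) = Σ_y P_Y(y)·Q(z|y) and P_{X|Y=y}(x) = P(x,y)/P_Y(y) (taken to be 0 if P_Y(y) = 0). Equivalently, I(X;Z) − I(X;Y) ≤ 128·(q−1)·⌊L^{1/(q−1)}⌋⁻². -/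
open Finset

/-- Shannon entropy of a (probability) vector on a finite set, natural log,
convention `0·log 0 = 0`. -/
noncomputable def Hent {X : Type*} [Fintype X] (u : X → ℝ) : ℝ := ∑ x, Real.negMulLog (u x)

/-- The `k`-th point of a grid of `n + 1` points in `[0, 1]`, refined near both endpoints. -/
noncomputable def gridPoint (n : ℕ) (k : ℝ) : ℝ := k ^ 2 / (k ^ 2 + (n - k) ^ 2)

lemma gridPoint_denom_lower (n k : ℝ) : n ^ 2 / 2 ≤ k ^ 2 + (n - k) ^ 2 := by
  nlinarith [sq_nonneg (n - 2 * k)]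

lemma gridPoint_denom_pos {n : ℕ} (hn : 1 ≤ n) (k : ℝ) : 0 < k ^ 2 + ((n : ℝ) - k) ^ 2 := by
  have hn' : (1 : ℝ) ≤ n := by exact_mod_cast hn
  have := gridPoint_denom_lower n k
  nlinarith

lemma gridPoint_nonneg (n : ℕ) (k : ℝ) : 0 ≤ gridPoint n k := by
  unfold gridPoint; positivity

lemma gridPoint_le_one (n : ℕ) (k : ℝ) : gridPoint n k ≤ 1 := by
  unfold gridPoint
  exact div_le_one_of_le₀ (by nlinarith [sq_nonneg ((n : ℝ) - k)]) (by positivity)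

lemma gridPoint_zero (n : ℕ) : gridPoint n 0 = 0 := by simp [gridPoint]

lemma gridPoint_self {n : ℕ} (hn : 1 ≤ n) : gridPoint n n = 1 := by
  have : (n : ℝ) ≠ 0 := by positivity
  simp [gridPoint, this]

lemma gridPoint_sub {n : ℕ} (hn : 1 ≤ n) (u s : ℝ) :
    gridPoint n u - gridPoint n s = n * (u - s) * (u * (n - s) + s * (n - u)) /
      ((u ^ 2 + ((n : ℝ) - u) ^ 2) * (s ^ 2 + ((n : ℝ) - s) ^ 2)) := by
  have h1 := (gridPoint_denom_pos hn u).ne'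
  have h2 := (gridPoint_denom_pos hn s).ne'
  unfold gridPoint
  rw [div_sub_div _ _ h1 h2]
  congr 1
  ring

lemma gridPoint_mul_one_sub {n : ℕ} (hn : 1 ≤ n) (s : ℝ) :
    gridPoint n s * (1 - gridPoint n s) =
      (s * (n - s)) ^ 2 / (s ^ 2 + ((n : ℝ) - s) ^ 2) ^ 2 := by
  have h2 := (gridPoint_denom_pos hn s).ne'
  unfold gridPoint
  rw [one_sub_div h2, div_mul_div_comm]
  congr 1 <;> ring

lemma exists_gridPoint_eq (n : ℕ) (hn : 1 ≤ n) {θ : ℝ} (h0 : 0 < θ) (h1 : θ < 1) :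
    ∃ s : ℝ, 0 < s ∧ s < n ∧ gridPoint n s = θ := by
  have hn' : (0 : ℝ) < n := by exact_mod_cast hn
  have ha : 0 < √θ := Real.sqrt_pos.2 h0
  have hb : 0 < √(1 - θ) := Real.sqrt_pos.2 (by linarith)
  have ha2 : √θ ^ 2 = θ := Real.sq_sqrt h0.le
  have hb2 : √(1 - θ) ^ 2 = 1 - θ := Real.sq_sqrt (by linarith)
  set a := √θ
  set b := √(1 - θ)
  have hab : 0 < a + b := by positivity
  refine ⟨n * a / (a + b), by positivity, ?_, ?_⟩
  · rw [div_lt_iff₀ hab]; nlinarith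
  · have e : (n : ℝ) - n * a / (a + b) = n * b / (a + b) := by field_simp; ring
    unfold gridPoint
    rw [e, div_pow, div_pow, mul_pow, mul_pow, ha2, hb2]
    field_simp
    ring

/-- On one cell of the grid, the variance of the two-point interpolation is small relative to the
variance of the Bernoulli distribution. -/
lemma gridPoint_variance_le {n : ℕ} (hn : 1 ≤ n) {k s : ℝ} (hk : 0 ≤ k) (hkn : k + 1 ≤ n)
    (hks : k ≤ s) (hsk : s ≤ k + 1) (hs0 : 0 < s) (hsn : s < n) :
    (gridPoint n (k + 1) - gridPoint n s) * (gridPoint n s - gridPoint n k) ≤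
      16 / (n : ℝ) ^ 2 * (gridPoint n s * (1 - gridPoint n s)) := by
  have hn' : (0 : ℝ) < n := by exact_mod_cast hn
  rw [gridPoint_sub hn, gridPoint_sub hn, gridPoint_mul_one_sub hn]
  have hU := gridPoint_denom_lower n (k + 1)
  have hK := gridPoint_denom_lower n k
  have hS := gridPoint_denom_pos hn s
  set U := (k + 1) ^ 2 + ((n : ℝ) - (k + 1)) ^ 2
  set K := k ^ 2 + ((n : ℝ) - k) ^ 2
  set S := s ^ 2 + ((n : ℝ) - s) ^ 2
  have hn2 : (0 : ℝ) < n ^ 2 / 2 := by positivity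
  have hU0 : 0 < U := hn2.trans_le hU
  have hK0 : 0 < K := hn2.trans_le hK
  have hUK : (n : ℝ) ^ 4 ≤ 4 * (U * K) := by
    have := mul_le_mul hU hK hn2.le hU0.le
    nlinarith
  have hd : 0 < (n : ℝ) - s := by linarith
  have A1 : (s - k) * ((k + 1) * (n - s) + s * (n - (k + 1))) ≤ 2 * (s * (n - s)) := by
    have : (k + 1) * (n - s) + s * (n - (k + 1)) ≤ 2 * ((k + 1) * (n - s)) := by nlinarith
    have h2 : (s - k) * (k + 1) ≤ s := by nlinarith
    calc _ ≤ (s - k) * (2 * ((k + 1) * (n - s))) :=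
          mul_le_mul_of_nonneg_left this (by linarith)
      _ = 2 * (n - s) * ((s - k) * (k + 1)) := by ring
      _ ≤ 2 * (n - s) * s := mul_le_mul_of_nonneg_left h2 (by linarith)
      _ = _ := by ring
  have A2 : (k + 1 - s) * (s * (n - k) + k * (n - s)) ≤ 2 * (s * (n - s)) := by
    have : s * (n - k) + k * (n - s) ≤ 2 * (s * (n - k)) := by nlinarith
    have h2 : (k + 1 - s) * (n - k) ≤ n - s := by nlinarith
    calc _ ≤ (k + 1 - s) * (2 * (s * (n - k))) :=
          mul_le_mul_of_nonneg_left this (by linarith)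
      _ = 2 * s * ((k + 1 - s) * (n - k)) := by ring
      _ ≤ 2 * s * (n - s) := mul_le_mul_of_nonneg_left h2 (by linarith)
      _ = _ := by ring
  have A : (s - k) * ((k + 1) * (n - s) + s * (n - (k + 1))) *
      ((k + 1 - s) * (s * (n - k) + k * (n - s))) ≤ 2 * (s * (n - s)) * (2 * (s * (n - s))) := by
    refine mul_le_mul A1 A2 ?_ (by positivity)
    have : 0 ≤ s * (n - k) + k * (n - s) :=
      add_nonneg (mul_nonneg hs0.le (by linarith)) (mul_nonneg hk hd.le)
    exact mul_nonneg (by linarith) this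
  rw [div_mul_div_comm, div_mul_div_comm, div_le_div_iff₀ (by positivity) (by positivity)]
  set M := s * ((n : ℝ) - s)
  calc _ = (n : ℝ) ^ 4 * S ^ 2 * ((s - k) * ((k + 1) * (n - s) + s * (n - (k + 1))) *
      ((k + 1 - s) * (s * (n - k) + k * (n - s)))) := by ring
    _ ≤ (n : ℝ) ^ 4 * S ^ 2 * (2 * M * (2 * M)) := mul_le_mul_of_nonneg_left A (by positivity)
    _ = 4 * M ^ 2 * S ^ 2 * (n : ℝ) ^ 4 := by ring
    _ ≤ 4 * M ^ 2 * S ^ 2 * (4 * (U * K)) := mul_le_mul_of_nonneg_left hUK (by positivity)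
    _ = _ := by ring

/-- The `χ²` upper bound on a single term of the relative entropy. -/
lemma neg_negMulLog_le {t θ : ℝ} (ht : 0 ≤ t) (hθ : 0 < θ) :
    -Real.negMulLog t ≤ t * Real.log θ + t * (t / θ - 1) := by
  rcases ht.eq_or_lt with rfl | ht
  · simp
  · have h := Real.log_le_sub_one_of_pos (div_pos ht hθ)
    rw [Real.log_div ht.ne' hθ.ne'] at h
    rw [Real.negMulLog]
    nlinarith

lemma neg_binEntropy_le {t θ : ℝ} (ht0 : 0 ≤ t) (ht1 : t ≤ 1) (h0 : 0 < θ) (h1 : θ < 1) :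
    -Real.binEntropy t ≤
      t * Real.log θ + (1 - t) * Real.log (1 - θ) + (t - θ) ^ 2 / (θ * (1 - θ)) := by
  have a := neg_negMulLog_le ht0 h0
  have b := neg_negMulLog_le (sub_nonneg.2 ht1) (sub_pos.2 h1)
  rw [Real.binEntropy_eq_negMulLog_add_negMulLog_one_sub]
  have e : t * (t / θ - 1) + (1 - t) * ((1 - t) / (1 - θ) - 1) = (t - θ) ^ 2 / (θ * (1 - θ)) := by
    have : θ ≠ 0 := h0.ne'
    have : 1 - θ ≠ 0 := (sub_pos.2 h1).ne'
    field_simp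
    ring
  linarith

lemma binEntropy_sub_interpolation_le {a b l m θ : ℝ} (ha0 : 0 ≤ a) (ha1 : a ≤ 1) (hb0 : 0 ≤ b)
    (hb1 : b ≤ 1) (hl : 0 ≤ l) (hm : 0 ≤ m) (hlm : l + m = 1) (hθ : l * a + m * b = θ)
    (h0 : 0 < θ) (h1 : θ < 1) :
    Real.binEntropy θ - (l * Real.binEntropy a + m * Real.binEntropy b) ≤
      (b - θ) * (θ - a) / (θ * (1 - θ)) := by
  have A := mul_le_mul_of_nonneg_left (neg_binEntropy_le ha0 ha1 h0 h1) hl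
  have B := mul_le_mul_of_nonneg_left (neg_binEntropy_le hb0 hb1 h0 h1) hm
  have hv : l * ((a - θ) ^ 2 / (θ * (1 - θ))) + m * ((b - θ) ^ 2 / (θ * (1 - θ))) =
      (b - θ) * (θ - a) / (θ * (1 - θ)) := by
    rw [← mul_div_assoc, ← mul_div_assoc, ← add_div]
    congr 1
    obtain rfl : l = 1 - m := by linarith
    subst hθ
    ring
  have hE : Real.binEntropy θ = -(θ * Real.log θ + (1 - θ) * Real.log (1 - θ)) := by
    rw [Real.binEntropy_eq_negMulLog_add_negMulLog_one_sub, Real.negMulLog, Real.negMulLog]; ring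
  have hlog : l * (a * Real.log θ + (1 - a) * Real.log (1 - θ)) +
      m * (b * Real.log θ + (1 - b) * Real.log (1 - θ)) =
      θ * Real.log θ + (1 - θ) * Real.log (1 - θ) := by
    obtain rfl : l = 1 - m := by linarith
    rw [← hθ]
    ring
  linarith

/-- Every Bernoulli parameter is a mixture of grid points at an entropy cost of order `n⁻²`. -/
lemma exists_grid_mixture {n : ℕ} (hn : 1 ≤ n) {θ : ℝ} (h0 : 0 ≤ θ) (h1 : θ ≤ 1) :
    ∃ w : Fin (n + 1) → ℝ, (∀ k, 0 ≤ w k) ∧ ∑ k, w k = 1 ∧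
      ∑ k, w k * gridPoint n (k : ℕ) = θ ∧
      Real.binEntropy θ - ∑ k, w k * Real.binEntropy (gridPoint n (k : ℕ)) ≤ 16 / (n : ℝ) ^ 2 := by
  rcases h0.eq_or_lt with rfl | h0
  · refine ⟨Pi.single 0 1, fun k => ?_, ?_, ?_, ?_⟩
    · by_cases h : k = 0 <;> simp [h]
    · simp
    · simp [Pi.single_apply, gridPoint_zero]
    · simp [Pi.single_apply, gridPoint_zero]
      positivity
  rcases h1.eq_or_lt with rfl | h1
  · refine ⟨Pi.single (Fin.last n) 1, fun k => ?_, ?_, ?_, ?_⟩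
    · by_cases h : k = Fin.last n <;> simp [h]
    · simp
    · simp [Pi.single_apply, gridPoint_self hn]
    · simp [Pi.single_apply, gridPoint_self hn]
      positivity
  obtain ⟨s, hs0, hsn, rfl⟩ := exists_gridPoint_eq n hn h0 h1
  obtain ⟨k, hks, hsk⟩ : ∃ k : ℕ, (k : ℝ) ≤ s ∧ s < k + 1 :=
    ⟨⌊s⌋₊, Nat.floor_le hs0.le, Nat.lt_floor_add_one s⟩
  have hkn : k < n := by exact_mod_cast hks.trans_lt hsn
  have hkn' : (k : ℝ) + 1 ≤ n := by exact_mod_cast hkn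
  have hn' : (0 : ℝ) < n := by exact_mod_cast hn
  have hk0 : (0 : ℝ) ≤ k := k.cast_nonneg
  have hvar := gridPoint_variance_le hn hk0 hkn' hks hsk.le hs0 hsn
  have hmono : ∀ {u v : ℝ}, 0 ≤ u → u ≤ v → v ≤ n → gridPoint n u ≤ gridPoint n v := by
    intro u v hu huv hv
    rw [← sub_nonneg, gridPoint_sub hn]
    have : 0 ≤ v * (n - u) + u * (n - v) :=
      add_nonneg (mul_nonneg (hu.trans huv) (by linarith)) (mul_nonneg hu (by linarith))
    have : 0 ≤ v - u := by linarith
    positivity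
  have hab : gridPoint n k < gridPoint n (k + 1) := by
    rw [← sub_pos, gridPoint_sub hn]
    have : 0 < ((k : ℝ) + 1) * (n - k) + k * (n - (k + 1)) :=
      add_pos_of_pos_of_nonneg (mul_pos (by linarith) (by linarith))
        (mul_nonneg hk0 (by linarith))
    have h1 := gridPoint_denom_pos hn k
    have h2 := gridPoint_denom_pos hn (k + 1)
    simp only [add_sub_cancel_left, mul_one]
    positivity
  have ha := hmono hk0 hks hsn.le
  have hb := hmono hs0.le hsk.le hkn'
  have ha0 := gridPoint_nonneg n k
  have hb1 := gridPoint_le_one n (k + 1)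
  have ha1 := gridPoint_le_one n k
  have hb0 := gridPoint_nonneg n (k + 1)
  set θ := gridPoint n s
  set a := gridPoint n k with ha_def
  set b := gridPoint n (k + 1) with hb_def
  have hd : 0 < b - a := sub_pos.2 hab
  let i : Fin (n + 1) := ⟨k, by omega⟩
  let j : Fin (n + 1) := ⟨k + 1, by omega⟩
  have hsum : ∀ f : Fin (n + 1) → ℝ,
      ∑ x, (Pi.single (M := fun _ => ℝ) i ((b - θ) / (b - a)) +
        Pi.single (M := fun _ => ℝ) j ((θ - a) / (b - a))) x * f x =
      (b - θ) / (b - a) * f i + (θ - a) / (b - a) * f j := by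
    intro f
    simp [Pi.single_apply, add_mul, Finset.sum_add_distrib]
  have hl : 0 ≤ (b - θ) / (b - a) := div_nonneg (by linarith) hd.le
  have hm : 0 ≤ (θ - a) / (b - a) := div_nonneg (by linarith) hd.le
  have hlm : (b - θ) / (b - a) + (θ - a) / (b - a) = 1 := by
    rw [← add_div, div_eq_one_iff_eq hd.ne']; ring
  have hθ : (b - θ) / (b - a) * a + (θ - a) / (b - a) * b = θ := by
    field_simp; ring
  have hi : gridPoint n ((i : ℕ) : ℝ) = a := rfl
  have hj : gridPoint n ((j : ℕ) : ℝ) = b := by simp [j, hb_def]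
  refine ⟨Pi.single i ((b - θ) / (b - a)) + Pi.single j ((θ - a) / (b - a)), fun x => ?_, ?_, ?_,
    ?_⟩
  · simp only [Pi.add_apply, Pi.single_apply]
    split_ifs <;> linarith
  · simpa [hlm] using hsum fun _ => 1
  · rw [hsum, hi, hj, hθ]
  · rw [hsum, hi, hj]
    refine (binEntropy_sub_interpolation_le ha0 ha1 hb0 hb1 hl hm hlm hθ h0 h1).trans ?_
    rw [div_le_iff₀ (mul_pos h0 (sub_pos.2 h1))]
    exact hvar

/-- Chain rule for the entropy: first decide whether the outcome is `0`, then draw the rest. -/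
lemma Hent_cons {N : ℕ} (a : ℝ) {r : Fin N → ℝ} (hr : ∑ x, r x = 1) :
    Hent (Fin.cons a (fun x => (1 - a) * r x) : Fin (N + 1) → ℝ) =
      Real.binEntropy a + (1 - a) * Hent r := by
  unfold Hent
  rw [Fin.sum_univ_succ, Real.binEntropy_eq_negMulLog_add_negMulLog_one_sub]
  simp only [Fin.cons_zero, Fin.cons_succ, Real.negMulLog_mul, Finset.sum_add_distrib,
    ← Finset.sum_mul, ← Finset.mul_sum, hr]
  ring

lemma exists_cons_eq {N : ℕ} {p : Fin (N + 2) → ℝ} (h0 : ∀ x, 0 ≤ p x) (h1 : ∑ x, p x = 1) :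
    ∃ r : Fin (N + 1) → ℝ, (∀ x, 0 ≤ r x) ∧ ∑ x, r x = 1 ∧
      p = Fin.cons (p 0) (fun x => (1 - p 0) * r x) := by
  have hs : ∑ x : Fin (N + 1), p x.succ = 1 - p 0 := by
    rw [Fin.sum_univ_succ] at h1; linarith
  by_cases h : 1 - p 0 = 0
  · refine ⟨Pi.single 0 1, fun k => ?_, by simp, ?_⟩
    · by_cases h : k = 0 <;> simp [h]
    · rw [h] at hs ⊢
      rw [Finset.sum_eq_zero_iff_of_nonneg fun i _ => h0 _] at hs
      funext x
      refine Fin.cases rfl (fun i => ?_) x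
      simp [hs i (Finset.mem_univ i)]
  · refine ⟨fun x => p x.succ / (1 - p 0), fun x => ?_, ?_, ?_⟩
    · exact div_nonneg (h0 _) (hs ▸ Finset.sum_nonneg fun i _ => h0 _)
    · rw [← Finset.sum_div, hs, div_self h]
    · funext x
      refine Fin.cases rfl (fun i => ?_) x
      simp [mul_div_cancel₀ _ h]

/-- A codebook of `(n + 1) ^ N` distributions on `N + 1` letters such that every distribution is a
mixture of codewords with a small loss of entropy. -/
lemma exists_codebook {n : ℕ} (hn : 1 ≤ n) (N : ℕ) :
    ∃ (ι : Type) (_ : Fintype ι) (R : ι → Fin (N + 1) → ℝ), Fintype.card ι = (n + 1) ^ N ∧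
      (∀ z x, 0 ≤ R z x) ∧ (∀ z, ∑ x, R z x = 1) ∧
      ∀ p : Fin (N + 1) → ℝ, (∀ x, 0 ≤ p x) → ∑ x, p x = 1 →
        ∃ Q : ι → ℝ, (∀ z, 0 ≤ Q z) ∧ ∑ z, Q z = 1 ∧ (∀ x, ∑ z, Q z * R z x = p x) ∧
          Hent p - ∑ z, Q z * Hent (R z) ≤ N * (16 / (n : ℝ) ^ 2) := by
  induction N with
  | zero =>
    refine ⟨Unit, inferInstance, fun _ _ => 1, by simp, by simp, by simp, fun p _ h1 => ?_⟩
    have hp : p = fun _ => 1 := by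
      funext x
      obtain rfl : x = 0 := Subsingleton.elim (α := Fin 1) x 0
      simpa using h1
    subst hp
    exact ⟨fun _ => 1, by simp, by simp, by simp, by simp⟩
  | succ N ih =>
    obtain ⟨ι, _, R, hcard, hR0, hR1, hR⟩ := ih
    refine ⟨Fin (n + 1) × ι, inferInstance,
      fun z => Fin.cons (gridPoint n (z.1 : ℕ)) fun x => (1 - gridPoint n (z.1 : ℕ)) * R z.2 x,
      ?_, ?_, ?_, fun p h0 h1 => ?_⟩
    · simp [hcard, pow_succ, mul_comm]
    · rintro ⟨k, z⟩ x
      refine Fin.cases ?_ (fun i => ?_) x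
      · exact gridPoint_nonneg _ _
      · exact mul_nonneg (sub_nonneg.2 (gridPoint_le_one _ _)) (hR0 _ _)
    · rintro ⟨k, z⟩
      rw [Fin.sum_univ_succ]
      simp [← Finset.mul_sum, hR1]
    · obtain ⟨r, hr0, hr1, hpr⟩ := exists_cons_eq h0 h1
      have hp1 : p 0 ≤ 1 := h1 ▸ Finset.single_le_sum (fun i _ => h0 i) (Finset.mem_univ 0)
      obtain ⟨w, hw0, hw1, hwθ, hwH⟩ := exists_grid_mixture hn (h0 0) hp1
      obtain ⟨Q, hQ0, hQ1, hQR, hQH⟩ := hR r hr0 hr1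
      have hprod : ∀ (f : Fin (n + 1) → ℝ) (g : ι → ℝ),
          ∑ z : Fin (n + 1) × ι, w z.1 * Q z.2 * (f z.1 * g z.2) =
            (∑ k, w k * f k) * ∑ z, Q z * g z := by
        intro f g
        rw [Fintype.sum_prod_type, Finset.sum_mul_sum]
        exact Finset.sum_congr rfl fun _ _ => Finset.sum_congr rfl fun _ _ => by ring
      have hcompl : ∑ k, w k * (1 - gridPoint n (k : ℕ)) = 1 - p 0 := by
        simp only [mul_sub, mul_one, Finset.sum_sub_distrib, hw1, hwθ]
      refine ⟨fun z => w z.1 * Q z.2, fun z => mul_nonneg (hw0 _) (hQ0 _), ?_, ?_, ?_⟩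
      · simpa [hw1, hQ1] using hprod (fun _ => 1) fun _ => 1
      · intro x
        refine Fin.cases ?_ (fun i => ?_) x
        · simpa [hwθ, hQ1] using hprod (fun k => gridPoint n (k : ℕ)) fun _ => 1
        · have := hprod (fun k => 1 - gridPoint n (k : ℕ)) fun z => R z i
          rw [hcompl, hQR] at this
          conv_rhs => rw [hpr]
          simpa using this
      · have hH : ∑ z : Fin (n + 1) × ι, w z.1 * Q z.2 *
            Hent (Fin.cons (gridPoint n (z.1 : ℕ))
              fun x => (1 - gridPoint n (z.1 : ℕ)) * R z.2 x : Fin (N + 2) → ℝ) =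
            ∑ k, w k * Real.binEntropy (gridPoint n (k : ℕ)) +
              (1 - p 0) * ∑ z, Q z * Hent (R z) := by
          have e1 := hprod (fun k => Real.binEntropy (gridPoint n (k : ℕ))) fun _ => 1
          have e2 := hprod (fun k => 1 - gridPoint n (k : ℕ)) fun z => Hent (R z)
          rw [hcompl] at e2
          simp only [mul_one, hQ1] at e1
          rw [← e1, ← e2, ← Finset.sum_add_distrib]
          exact Finset.sum_congr rfl fun z _ => by rw [Hent_cons _ (hR1 _)]; ring
        have hHp : Hent p = Real.binEntropy (p 0) + (1 - p 0) * Hent r := by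
          conv_lhs => rw [hpr]
          exact Hent_cons _ hr1
        rw [hH, hHp]
        have hC : 0 ≤ (N : ℝ) * (16 / (n : ℝ) ^ 2) := by positivity
        have h2 : (1 - p 0) * (Hent r - ∑ z, Q z * Hent (R z)) ≤ N * (16 / (n : ℝ) ^ 2) := by
          have h3 := mul_le_mul_of_nonneg_left hQH (sub_nonneg.2 hp1)
          have h4 := mul_nonneg (h0 0) hC
          nlinarith
        push_cast
        linarith

lemma Hent_comp_equiv {X X' : Type*} [Fintype X] [Fintype X'] (e : X ≃ X') (u : X' → ℝ) :
    Hent (fun x => u (e x)) = Hent u :=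
  e.sum_comp fun x => Real.negMulLog (u x)

lemma exists_codebook_fin {X : Type*} [Fintype X] (hX : 2 ≤ Fintype.card X) {n : ℕ} (hn : 1 ≤ n) :
    ∃ R : Fin ((n + 1) ^ (Fintype.card X - 1)) → X → ℝ,
      (∀ z x, 0 ≤ R z x) ∧ (∀ z, ∑ x, R z x = 1) ∧
      ∀ p : X → ℝ, (∀ x, 0 ≤ p x) → ∑ x, p x = 1 →
        ∃ Q : Fin ((n + 1) ^ (Fintype.card X - 1)) → ℝ,
          (∀ z, 0 ≤ Q z) ∧ ∑ z, Q z = 1 ∧ (∀ x, ∑ z, Q z * R z x = p x) ∧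
          Hent p - ∑ z, Q z * Hent (R z) ≤
            ((Fintype.card X : ℝ) - 1) * (16 / (n : ℝ) ^ 2) := by
  obtain ⟨ι, _, R, hcard, hR0, hR1, hR⟩ := exists_codebook hn (Fintype.card X - 1)
  have e : X ≃ Fin (Fintype.card X - 1 + 1) := Fintype.equivFinOfCardEq (by omega)
  have f : ι ≃ Fin ((n + 1) ^ (Fintype.card X - 1)) := Fintype.equivFinOfCardEq hcard
  refine ⟨fun z x => R (f.symm z) (e x), fun _ _ => hR0 _ _, fun z => ?_, fun p h0 h1 => ?_⟩
  · rw [e.sum_comp (R (f.symm z)), hR1]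
  · obtain ⟨Q, hQ0, hQ1, hQR, hQH⟩ := hR (fun x => p (e.symm x)) (fun _ => h0 _)
      (by rw [e.symm.sum_comp p, h1])
    refine ⟨fun z => Q (f.symm z), fun _ => hQ0 _, ?_, fun x => ?_, ?_⟩
    · rw [f.symm.sum_comp Q, hQ1]
    · rw [f.symm.sum_comp fun z => Q z * R z (e x), hQR, e.symm_apply_apply]
    · simp only [Hent_comp_equiv e]
      rw [f.symm.sum_comp fun z => Q z * Hent (R z)]
      rw [Hent_comp_equiv e.symm, Nat.cast_sub (by omega), Nat.cast_one] at hQH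
      exact hQH

/-- One-hot upgrading for general input alphabets: given a joint pmf `P` on `𝒳 × 𝒴` with
`|𝒳| = q ≥ 2` and `L ≥ 2^{q-1}`, there is an upgraded channel `Y → Z → X` with
`|𝒵| ≤ L` whose increase in mutual information `I(X;Z) − I(X;Y) = H(X|Y) − H(X|Z)` is at
most `128·(q−1)·⌊L^{1/(q−1)}⌋⁻²`. -/
theorem onehot_upgrading {X Y : Type*} [Fintype X] [Fintype Y]
    (hq : 2 ≤ Fintype.card X)
    (P : X → Y → ℝ)
    (hP0 : ∀ x y, 0 ≤ P x y)
    (hP1 : ∑ x : X, ∑ y : Y, P x y = 1)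
    (L : ℕ) (hL : 2 ^ (Fintype.card X - 1) ≤ L) :
    ∃ (m : ℕ) (Q : Y → Fin m → ℝ) (R : Fin m → X → ℝ),
      m ≤ L ∧
      (∀ y z, 0 ≤ Q y z) ∧ (∀ y, ∑ z, Q y z = 1) ∧
      (∀ z x, 0 ≤ R z x) ∧ (∀ z, ∑ x, R z x = 1) ∧
      (∀ x y, P x y = (∑ x' : X, P x' y) * ∑ z, Q y z * R z x) ∧
      (∑ y : Y, (∑ x : X, P x y) * Hent (fun x => P x y / ∑ x' : X, P x' y))
        - (∑ z : Fin m, (∑ y : Y, (∑ x : X, P x y) * Q y z) * Hent (R z))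
        ≤ 128 * ((Fintype.card X : ℝ) - 1) /
            ((⌊(L : ℝ) ^ ((1 : ℝ) / ((Fintype.card X : ℝ) - 1))⌋₊ : ℝ)) ^ 2 := by
  have hN : (0 : ℝ) < (Fintype.card X : ℝ) - 1 := by
    have : (2 : ℝ) ≤ Fintype.card X := by exact_mod_cast hq
    linarith
  have hcast : ((Fintype.card X - 1 : ℕ) : ℝ) = (Fintype.card X : ℝ) - 1 := by
    rw [Nat.cast_sub (by omega), Nat.cast_one]
  have hL0 : (0 : ℝ) ≤ L := L.cast_nonneg
  set Λ := ⌊(L : ℝ) ^ ((1 : ℝ) / ((Fintype.card X : ℝ) - 1))⌋₊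
  have hroot : ((L : ℝ) ^ ((1 : ℝ) / ((Fintype.card X : ℝ) - 1))) ^ (Fintype.card X - 1) = L := by
    rw [← Real.rpow_natCast, ← Real.rpow_mul hL0, hcast, one_div, inv_mul_cancel₀ hN.ne',
      Real.rpow_one]
  have hΛL : Λ ^ (Fintype.card X - 1) ≤ L := by
    have h : (Λ : ℝ) ≤ (L : ℝ) ^ ((1 : ℝ) / ((Fintype.card X : ℝ) - 1)) :=
      Nat.floor_le (by positivity)
    have h2 := pow_le_pow_left₀ Λ.cast_nonneg h (Fintype.card X - 1)
    rw [hroot] at h2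
    exact_mod_cast h2
  have hΛ2 : 2 ≤ Λ := by
    refine Nat.le_floor (le_of_pow_le_pow_left₀ (n := Fintype.card X - 1) (by omega)
      (by positivity) ?_)
    rw [hroot]
    exact_mod_cast hL
  obtain ⟨n, hn⟩ : ∃ n, Λ = n + 1 := ⟨Λ - 1, by omega⟩
  have hn1 : 1 ≤ n := by omega
  rw [hn] at hΛL ⊢
  obtain ⟨R, hR0, hR1, hR⟩ := exists_codebook_fin hq hn1
  have hX : Nonempty X := Fintype.card_pos_iff.1 (by omega)
  set C := ((Fintype.card X : ℝ) - 1) * (16 / (n : ℝ) ^ 2)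
  have hPY0 : ∀ y, 0 ≤ ∑ x, P x y := fun y => Finset.sum_nonneg fun x _ => hP0 x y
  have hcol : ∀ y, ∃ Q : Fin ((n + 1) ^ (Fintype.card X - 1)) → ℝ,
      (∀ z, 0 ≤ Q z) ∧ ∑ z, Q z = 1 ∧
      (∀ x, P x y = (∑ x', P x' y) * ∑ z, Q z * R z x) ∧
      (∑ x, P x y) * Hent (fun x => P x y / ∑ x', P x' y) -
        (∑ x, P x y) * ∑ z, Q z * Hent (R z) ≤ (∑ x, P x y) * C := by
    intro y
    by_cases h : ∑ x, P x y = 0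
    · classical
      obtain ⟨x₀⟩ := hX
      obtain ⟨Q, hQ0, hQ1, -, -⟩ := hR (Pi.single x₀ 1)
        (fun x => by by_cases h : x = x₀ <;> simp [h]) (by simp)
      refine ⟨Q, hQ0, hQ1, fun x => ?_, by simp [h]⟩
      rw [h, zero_mul]
      exact (Finset.sum_eq_zero_iff_of_nonneg fun x _ => hP0 x y).1 h x (Finset.mem_univ x)
    · obtain ⟨Q, hQ0, hQ1, hQR, hQH⟩ := hR (fun x => P x y / ∑ x', P x' y)
        (fun x => div_nonneg (hP0 x y) (hPY0 y)) (by rw [← Finset.sum_div, div_self h])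
      refine ⟨Q, hQ0, hQ1, fun x => ?_, ?_⟩
      · rw [hQR, mul_div_cancel₀ _ h]
      · rw [← mul_sub]
        exact mul_le_mul_of_nonneg_left hQH (hPY0 y)
  choose Q hQ0 hQ1 hQR hQH using hcol
  refine ⟨_, Q, R, hΛL, hQ0, hQ1, hR0, hR1, fun x y => hQR y x, ?_⟩
  have hswap : ∑ z, (∑ y, (∑ x, P x y) * Q y z) * Hent (R z) =
      ∑ y, (∑ x, P x y) * ∑ z, Q y z * Hent (R z) := by
    simp only [Finset.sum_mul _ _ (Hent _), Finset.mul_sum]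
    rw [Finset.sum_comm]
    exact Finset.sum_congr rfl fun _ _ => Finset.sum_congr rfl fun _ _ => by ring
  rw [hswap, ← Finset.sum_sub_distrib]
  calc _ ≤ ∑ y, (∑ x, P x y) * C := Finset.sum_le_sum fun y _ => hQH y
    _ = C := by rw [← Finset.sum_mul, Finset.sum_comm, hP1, one_mul]
    _ ≤ _ := by
      have h1 : (1 : ℝ) ≤ n := by exact_mod_cast hn1
      simp only [C]
      rw [← mul_div_assoc, div_le_div_iff₀ (by positivity) (by positivity)]
      push_cast
      have h2 : 16 * ((n : ℝ) + 1) ^ 2 ≤ 128 * (n : ℝ) ^ 2 := by nlinarith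
      calc _ = ((Fintype.card X : ℝ) - 1) * (16 * ((n : ℝ) + 1) ^ 2) := by ring
        _ ≤ ((Fintype.card X : ℝ) - 1) * (128 * (n : ℝ) ^ 2) :=
          mul_le_mul_of_nonneg_left h2 hN.le
        _ = _ := by ring
end

section
/- With the one-hot upgrading construction described in the context, marginalizing P* over z recovers the original joint distribution: for every x ∈ 𝒳 and y ∈ 𝒴, Σ_{z∈𝒵} P*(x,z,y) = P(x,y). -/
open Finset

/-- The joint distribution `P*(x,z,y)` of the one-hot upgrading construction.
Here `𝒳 = Fin q` (with `x : Fin q` representing the symbol `x+1 ∈ {1,…,q}`),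
`z` is a tuple of the binary-upgrading outputs, and the last product is the
one-hot conditional `∏ᵢ γᵢ(xᵢ | zᵢ, x₁^{i−1})`: for `x = i` (prefix all zero, bit 1)
it contributes `cᵢ(zᵢ)`; for `x > i` (prefix all zero, bit 0) it contributes
`1 − cᵢ(zᵢ)`; for `x < i` (prefix nonzero, bit 0) it contributes `1`. -/
noncomputable def Pstar {q : ℕ} {Y : Type*} [Fintype Y] {Z : Fin (q - 1) → Type*}
    (P : Fin q → Y → ℝ) (B : (i : Fin (q - 1)) → Y → Z i → ℝ)
    (c : (i : Fin (q - 1)) → Z i → ℝ)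
    (x : Fin q) (z : (i : Fin (q - 1)) → Z i) (y : Y) : ℝ :=
  (∑ x' : Fin q, P x' y) * (∏ i : Fin (q - 1), B i y (z i)) *
    ∏ i : Fin (q - 1),
      (if x.val = i.val then c i (z i) else if i.val < x.val then 1 - c i (z i) else 1)

/-- The tail sums of `p` over `Fin q` lose the term `p k` when the threshold `k` is raised by one. -/
theorem sum_filter_le_eq_add {q : ℕ} (p : Fin q → ℝ) (k : Fin q) :
    ∑ x ∈ Finset.univ.filter (fun x : Fin q => k.val ≤ x.val), p x =
      p k + ∑ x ∈ Finset.univ.filter (fun x : Fin q => k.val + 1 ≤ x.val), p x := by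
  have h : Finset.univ.filter (fun x : Fin q => k.val ≤ x.val) =
      insert k (Finset.univ.filter (fun x : Fin q => k.val + 1 ≤ x.val)) := by
    ext x
    simp only [Finset.mem_filter, Finset.mem_univ, true_and, Finset.mem_insert, Fin.ext_iff]
    omega
  rw [h, Finset.sum_insert (by simp)]

/-- Telescoping of the one-hot conditional probabilities: `T k` is the tail mass at `k` and `r` the
mass at `n`. -/
theorem mul_prod_range_onehot (T : ℕ → ℝ) (r : ℝ) (n m : ℕ) (hT : ∀ k < m, T k ≠ 0) :
    T 0 * ∏ k ∈ Finset.range m,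
      (if n = k then r / T k else if k < n then T (k + 1) / T k else 1) =
      if m ≤ n then T m else r := by
  induction m with
  | zero => simp
  | succ m ih =>
    rw [Finset.prod_range_succ, ← mul_assoc, ih fun k hk => hT k (by omega)]
    have hm : T m ≠ 0 := hT m (by omega)
    rcases lt_trichotomy m n with h | h | h
    · rw [if_pos h.le, if_neg h.ne', if_pos h, if_pos (by omega), mul_div_cancel₀ _ hm]
    · rw [if_pos h.le, if_pos h.symm, if_neg (by omega), mul_div_cancel₀ _ hm]
    · rw [if_neg (by omega), if_neg h.ne, if_neg (by omega), if_neg (by omega), mul_one]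

/-- Marginalizing the one-hot upgrading construction `P*` over `z` recovers the
original joint distribution `P`. -/
theorem onehot_marginalizes {q : ℕ} (hq : 2 ≤ q) {Y : Type*} [Fintype Y]
    {Z : Fin (q - 1) → Type*} [∀ i, Fintype (Z i)]
    (P : Fin q → Y → ℝ)
    (B : (i : Fin (q - 1)) → Y → Z i → ℝ)
    (c : (i : Fin (q - 1)) → Z i → ℝ)
    (hP0 : ∀ x y, 0 ≤ P x y)
    (hP1 : ∑ x : Fin q, ∑ y : Y, P x y = 1)
    (hpos : ∀ (i : Fin (q - 1)) (y : Y),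
      0 < ∑ x ∈ Finset.univ.filter (fun x : Fin q => i.val ≤ x.val), P x y)
    (hB0 : ∀ (i : Fin (q - 1)) (y : Y) (z : Z i), 0 ≤ B i y z)
    (hB1 : ∀ (i : Fin (q - 1)) (y : Y), ∑ z : Z i, B i y z = 1)
    (hc : ∀ (i : Fin (q - 1)) (z : Z i), 0 ≤ c i z ∧ c i z ≤ 1)
    (hmatch : ∀ (i : Fin (q - 1)) (y : Y),
      ∑ z : Z i, B i y z * c i z =
        P ⟨i.val, by have := i.isLt; omega⟩ y /
          ∑ x ∈ Finset.univ.filter (fun x : Fin q => i.val ≤ x.val), P x y) :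
    ∀ (x : Fin q) (y : Y),
      ∑ z : ((i : Fin (q - 1)) → Z i), Pstar P B c x z y = P x y := by
  intro x y
  let T : ℕ → ℝ := fun k => ∑ x ∈ Finset.univ.filter (fun x : Fin q => k ≤ x.val), P x y
  have hT0 : ∑ x' : Fin q, P x' y = T 0 := by simp [T]
  have hTpos : ∀ k < q - 1, T k ≠ 0 := fun k hk => (hpos ⟨k, hk⟩ y).ne'
  have hfactor : ∀ i : Fin (q - 1),
      ∑ z : Z i, B i y z *
        (if x.val = i.val then c i z else if i.val < x.val then 1 - c i z else 1) =
      if x.val = i.val then P x y / T i.val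
        else if i.val < x.val then T (i.val + 1) / T i.val else 1 := by
    intro i
    have hi : i.val < q := by omega
    split_ifs with h h'
    · rw [hmatch]
      congr 2
      exact Fin.ext h.symm
    · have hrec : T i.val = P ⟨i.val, hi⟩ y + T (i.val + 1) :=
        sum_filter_le_eq_add (fun x => P x y) ⟨i.val, hi⟩
      have hne := hTpos i.val i.isLt
      simp only [mul_sub, mul_one, Finset.sum_sub_distrib, hB1, hmatch]
      change 1 - P ⟨i.val, hi⟩ y / T i.val = _
      rw [one_sub_div hne, hrec, add_sub_cancel_left]
    · simp only [mul_one, hB1]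
  classical
  have hsum : ∑ z : ((i : Fin (q - 1)) → Z i), Pstar P B c x z y =
      T 0 * ∏ k ∈ Finset.range (q - 1), (if x.val = k then P x y / T k
        else if k < x.val then T (k + 1) / T k else 1) := by
    simp only [Pstar, mul_assoc, ← Finset.prod_mul_distrib]
    rw [← Finset.mul_sum, hT0, ← Fintype.prod_sum (fun i z => B i y z *
      (if x.val = i.val then c i z else if i.val < x.val then 1 - c i z else 1)),
      Finset.prod_congr rfl fun i _ => hfactor i,
      Fin.prod_univ_eq_prod_range (fun k => if x.val = k then P x y / T k
        else if k < x.val then T (k + 1) / T k else 1)]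
  rw [hsum, mul_prod_range_onehot T (P x y) x.val (q - 1) hTpos]
  split_ifs with h
  · have hx : x.val = q - 1 := by omega
    have hempty : Finset.univ.filter (fun x' : Fin q => x.val + 1 ≤ x'.val) = ∅ :=
      Finset.filter_eq_empty_iff.mpr fun x' _ => by omega
    rw [← hx]
    change ∑ x' ∈ Finset.univ.filter (fun x' : Fin q => x.val ≤ x'.val), P x' y = _
    rw [sum_filter_le_eq_add (fun x => P x y) x, hempty, Finset.sum_empty, add_zero]
  · rfl
end

section
/- In the one-hot upgrading construction described in the context, for every j ∈ {1,…,q−1}, x' ∈ {0,1}, z* ∈ 𝒵_j and y ∈ 𝒴, the sum of P*(x,z,y) over all x ∈ 𝒳 with x = j (if x' = 1) or x ≥ j+1 (if x' = 0) and over all z ∈ 𝒵 with z_j = z*, equals P(X ≥ j)·β⁽ʲ⁾(x', z*, y), where P(X ≥ j) = Σ_{x ≥ j, y} P(x,y) and β⁽ʲ⁾(x', z, y) = A_j(y)·B_j(z|y)·(c_j(z) if x' = 1, else 1 − c_j(z)) with A_j(y) = P(X ≥ j, Y = y)/P(X ≥ j). Equivalently, conditioned on the event X₁^{j−1} = 0₁^{j−1}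 (i.e. X ≥ j), the joint distribution of (X_j, Z_j, Y) under P* is β⁽ʲ⁾. -/
open Finset

/-- The product of `r i` over `i < m`, written as a product over all of `Fin n`. -/
noncomputable def prodBelow {n : ℕ} (r : Fin n → ℝ) (m : ℕ) : ℝ :=
  ∏ i : Fin n, if i.val < m then r i else 1

lemma prodBelow_zero {n : ℕ} (r : Fin n → ℝ) : prodBelow r 0 = 1 := by
  simp [prodBelow]

lemma prod_ite_lt_ite_eq {n : ℕ} (r s : Fin n → ℝ) (j : Fin n) :
    (∏ i : Fin n, if i.val < j.val then r i else if i = j then s i else 1)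
      = prodBelow r j * s j := by
  have hs : s j = ∏ i : Fin n, if i = j then s i else 1 := by simp
  rw [prodBelow, hs, ← Finset.prod_mul_distrib]
  refine Finset.prod_congr rfl fun i _ => ?_
  by_cases h : i = j
  · subst h; simp
  · simp [h]

lemma prodBelow_succ {n : ℕ} (r : Fin n → ℝ) (j : Fin n) :
    prodBelow r (j.val + 1) = prodBelow r j * r j := by
  rw [← prod_ite_lt_ite_eq, prodBelow]
  refine Finset.prod_congr rfl fun i _ => ?_
  have := Fin.ext_iff (a := i) (b := j)
  grind

/-- The weight that stick-breaking with parameters `d` assigns to the symbol `x`. -/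
lemma prod_onehot_eq {n : ℕ} (d : Fin n → ℝ) (j : Fin n) {x : ℕ} (hx : x = j.val) :
    (∏ i : Fin n, if x = i.val then d i else if i.val < x then 1 - d i else 1)
      = prodBelow (fun i => 1 - d i) j * d j := by
  rw [← prod_ite_lt_ite_eq]
  refine Finset.prod_congr rfl fun i _ => ?_
  have := Fin.ext_iff (a := i) (b := j)
  grind

lemma sum_filter_le_val {n : ℕ} (f : Fin (n + 1) → ℝ) (j : Fin n) :
    ∑ x ∈ univ.filter (fun x : Fin (n + 1) => j.val ≤ x.val), f x
      = f j.castSucc + ∑ x ∈ univ.filter (fun x : Fin (n + 1) => j.val + 1 ≤ x.val), f x := by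
  rw [← Finset.sum_insert (by simp)]
  congr 1
  ext x
  simp only [mem_filter, mem_univ, true_and, mem_insert, Fin.ext_iff, Fin.val_castSucc]
  omega

/-- Stick-breaking telescopes: the weights of the symbols `x ≥ m` add up to
`∏ i < m, (1 - d i)`. -/
lemma sum_onehot_ge {n : ℕ} (d : Fin n → ℝ) {m : ℕ} (hm : m ≤ n) :
    (∑ x ∈ univ.filter (fun x : Fin (n + 1) => m ≤ x.val),
      ∏ i : Fin n, if x.val = i.val then d i else if i.val < x.val then 1 - d i else 1)
      = prodBelow (fun i => 1 - d i) m := by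
  induction hm using Nat.decreasingInduction with
  | self =>
    have hs : univ.filter (fun x : Fin (n + 1) => n ≤ x.val) = {Fin.last n} := by
      ext x
      simp only [mem_filter, mem_univ, true_and, mem_singleton, Fin.ext_iff, Fin.val_last]
      omega
    rw [hs, Finset.sum_singleton, prodBelow]
    refine Finset.prod_congr rfl fun i _ => ?_
    simp [i.isLt, i.isLt.ne']
  | of_succ k hk ih =>
    rw [sum_filter_le_val _ (⟨k, hk⟩ : Fin n), ih,
      prod_onehot_eq d ⟨k, hk⟩ (Fin.val_castSucc _),
      prodBelow_succ _ (⟨k, hk⟩ : Fin n)]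
    ring

/-- The hazard rates `a i = p i / ∑ x ≥ i, p x` recover the tail sums of `p`. -/
lemma sum_mul_prodBelow_hazard {n : ℕ} (p : Fin (n + 1) → ℝ) (a : Fin n → ℝ)
    (hpos : ∀ i : Fin n, 0 < ∑ x ∈ univ.filter (fun x : Fin (n + 1) => i.val ≤ x.val), p x)
    (ha : ∀ i : Fin n,
      a i = p i.castSucc / ∑ x ∈ univ.filter (fun x : Fin (n + 1) => i.val ≤ x.val), p x)
    {m : ℕ} (hm : m ≤ n) :
    (∑ x, p x) * prodBelow (fun i => 1 - a i) m
      = ∑ x ∈ univ.filter (fun x : Fin (n + 1) => m ≤ x.val), p x := by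
  induction m with
  | zero => simp [prodBelow_zero]
  | succ k ih =>
    have h := sum_filter_le_val p (⟨k, hm⟩ : Fin n)
    have hk := hpos ⟨k, hm⟩
    have hak := ha ⟨k, hm⟩
    rw [prodBelow_succ _ (⟨k, hm⟩ : Fin n), ← mul_assoc, ih (by omega), hak]
    simp only at h hk ⊢
    rw [mul_sub, mul_div_cancel₀ _ hk.ne']
    linarith

/-- Summing a product over the functions with a prescribed value at `j`. -/
lemma sum_filter_apply_eq_prod {ι : Type*} [Fintype ι] [DecidableEq ι] {Z : ι → Type*}
    [∀ i, Fintype (Z i)] [∀ i, DecidableEq (Z i)] (g : (i : ι) → Z i → ℝ) (j : ι) (zs : Z j) :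
    ∑ z ∈ univ.filter (fun z : (i : ι) → Z i => z j = zs), ∏ i, g i (z i)
      = ∏ i, if i = j then g j zs else ∑ z, g i z := by
  have hs : univ.filter (fun z : (i : ι) → Z i => z j = zs)
      = Fintype.piFinset (Function.update (fun i => (univ : Finset (Z i))) j {zs}) := by
    ext z
    simp only [mem_filter, mem_univ, true_and, Fintype.mem_piFinset]
    refine ⟨fun h i => ?_, fun h => by simpa using h j⟩
    by_cases hi : i = j
    · subst hi; simpa using h
    · simp [hi]
  rw [hs, ← Finset.prod_univ_sum]
  refine Finset.prod_congr rfl fun i _ => ?_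
  by_cases hi : i = j
  · subst hi; simp
  · simp [hi]

/-- The stick-breaking weight of the event that bit `j` equals `b` and all earlier bits
vanish. -/
lemma sum_onehot_bit {n : ℕ} (d : Fin n → ℝ) (j : Fin n) (b : Bool) :
    ∑ x ∈ univ.filter (fun x : Fin (n + 1) => if b then x.val = j.val else j.val < x.val),
      (∏ i : Fin n, if x.val = i.val then d i else if i.val < x.val then 1 - d i else 1)
    = ∏ i : Fin n, if i.val < j.val then 1 - d i
        else if i = j then (if b then d i else 1 - d i) else 1 := by
  rw [prod_ite_lt_ite_eq (fun i => 1 - d i) (fun i => if b then d i else 1 - d i)]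
  cases b with
  | true =>
    have hs : univ.filter (fun x : Fin (n + 1) => x.val = j.val) = {j.castSucc} := by
      ext x
      simp [Fin.ext_iff]
    simp only [if_true, hs, Finset.sum_singleton]
    exact prod_onehot_eq d j (Fin.val_castSucc j)
  | false =>
    simp only [Bool.false_eq_true, if_false]
    rw [← prodBelow_succ (fun i => 1 - d i) j]
    exact sum_onehot_ge d j.isLt

/-- The one-hot construction over a single output symbol: `p` is the slice of the joint law,
`B i` the distribution of `z i`, and `c i` the conditional probability of bit `i`. -/
lemma sum_onehot_marginal {n : ℕ} {Z : Fin n → Type*} [∀ i, Fintype (Z i)]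
    [∀ i, DecidableEq (Z i)] (p : Fin (n + 1) → ℝ) (B c : (i : Fin n) → Z i → ℝ)
    (hpos : ∀ i : Fin n, 0 < ∑ x ∈ univ.filter (fun x : Fin (n + 1) => i.val ≤ x.val), p x)
    (hB : ∀ i, ∑ z, B i z = 1)
    (hmatch : ∀ i : Fin n, ∑ z, B i z * c i z
      = p i.castSucc / ∑ x ∈ univ.filter (fun x : Fin (n + 1) => i.val ≤ x.val), p x)
    (j : Fin n) (b : Bool) (zs : Z j) :
    ∑ x ∈ univ.filter (fun x : Fin (n + 1) => if b then x.val = j.val else j.val < x.val),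
      ∑ z ∈ univ.filter (fun z : (i : Fin n) → Z i => z j = zs),
        (∑ x', p x') * (∏ i, B i (z i)) *
          (∏ i : Fin n,
            if x.val = i.val then c i (z i) else if i.val < x.val then 1 - c i (z i) else 1)
    = (∑ x ∈ univ.filter (fun x : Fin (n + 1) => j.val ≤ x.val), p x) *
        (B j zs * if b then c j zs else 1 - c j zs) := by
  rw [Finset.sum_comm]
  have hbit (z : (i : Fin n) → Z i) := sum_onehot_bit (fun i => c i (z i)) j b
  simp only [← Finset.mul_sum, mul_assoc, hbit]
  simp only [← Finset.prod_mul_distrib]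
  rw [sum_filter_apply_eq_prod (fun i z => B i z * if i.val < j.val then 1 - c i z
      else if i = j then (if b then c i z else 1 - c i z) else 1),
    ← sum_mul_prodBelow_hazard p (fun i => ∑ z, B i z * c i z) hpos hmatch j.isLt.le, mul_assoc,
    ← prod_ite_lt_ite_eq _ (fun _ => B j zs * if b then c j zs else 1 - c j zs)]
  congr 1
  refine Finset.prod_congr rfl fun i _ => ?_
  by_cases hij : i = j
  · subst hij; simp
  · by_cases hlt : i.val < j.val
    · simp [hij, hlt, mul_sub, hB]
    · simp [hij, hlt, hB]

/-- The binary upgrading component `β⁽ʲ⁾` is embedded in the one-hot construction: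
conditioned on `X₁^{j-1} = 0` (i.e. `X ≥ j`), the joint law of `(X_j, Z_j, Y)` under `P*`
is `β⁽ʲ⁾(x',z,y) = A_j(y)·B_j(z|y)·(c_j(z) if x'=1 else 1−c_j(z))`, where
`A_j(y) = P(X ≥ j, Y=y)/P(X ≥ j)`.  Stated unconditionally: the sum of `P*(x,z,y)` over
`x` with `x = j` (if `x' = 1`) resp. `x ≥ j+1` (if `x' = 0`) and over `z` with
`z_j = z*` equals `P(X ≥ j)·β⁽ʲ⁾(x', z*, y)`. -/
theorem onehot_embeds_beta {q : ℕ} (hq : 2 ≤ q) {Y : Type*} [Fintype Y]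
    {Z : Fin (q - 1) → Type*} [∀ i, Fintype (Z i)] [∀ i, DecidableEq (Z i)]
    (P : Fin q → Y → ℝ)
    (B : (i : Fin (q - 1)) → Y → Z i → ℝ)
    (c : (i : Fin (q - 1)) → Z i → ℝ)
    (hP0 : ∀ x y, 0 ≤ P x y)
    (hP1 : ∑ x : Fin q, ∑ y : Y, P x y = 1)
    (hpos : ∀ (i : Fin (q - 1)) (y : Y),
      0 < ∑ x ∈ Finset.univ.filter (fun x : Fin q => i.val ≤ x.val), P x y)
    (hB0 : ∀ (i : Fin (q - 1)) (y : Y) (z : Z i), 0 ≤ B i y z)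
    (hB1 : ∀ (i : Fin (q - 1)) (y : Y), ∑ z : Z i, B i y z = 1)
    (hc : ∀ (i : Fin (q - 1)) (z : Z i), 0 ≤ c i z ∧ c i z ≤ 1)
    (hmatch : ∀ (i : Fin (q - 1)) (y : Y),
      ∑ z : Z i, B i y z * c i z =
        P ⟨i.val, by have := i.isLt; omega⟩ y /
          ∑ x ∈ Finset.univ.filter (fun x : Fin q => i.val ≤ x.val), P x y) :
    ∀ (j : Fin (q - 1)) (x' : Bool) (zs : Z j) (y : Y),
      (∑ x ∈ Finset.univ.filter
          (fun x : Fin q => if x' then x.val = j.val else j.val < x.val),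
        ∑ z ∈ Finset.univ.filter (fun z : (i : Fin (q - 1)) → Z i => z j = zs),
          Pstar P B c x z y)
      = (∑ y' : Y, ∑ x ∈ Finset.univ.filter (fun x : Fin q => j.val ≤ x.val), P x y') *
          (((∑ x ∈ Finset.univ.filter (fun x : Fin q => j.val ≤ x.val), P x y) /
              (∑ y' : Y, ∑ x ∈ Finset.univ.filter (fun x : Fin q => j.val ≤ x.val), P x y')) *
            B j y zs * (if x' then c j zs else 1 - c j zs)) := by
  intro j x' zs y
  obtain ⟨n, rfl⟩ : ∃ n, q = n + 1 := ⟨q - 1, by omega⟩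
  have hS : 0 < ∑ y' : Y, ∑ x ∈ univ.filter (fun x : Fin (n + 1) => j.val ≤ x.val), P x y' :=
    Finset.sum_pos (fun y' _ => hpos j y') ⟨y, mem_univ y⟩
  rw [mul_assoc (_ / _), ← mul_assoc (∑ y' : Y, _), mul_div_cancel₀ _ hS.ne']
  exact sum_onehot_marginal (n := n) (fun x => P x y) (fun i => B i y) c
    (fun i => hpos i y) (fun i => hB1 i y) (fun i => hmatch i y) j x' zs
end

section
/- In the one-hot upgrading construction described in the context, suppose additionally that for some ε ≥ 0 and every i ∈ {1,…,q−1} the i-th binary component satisfies Σ_{y∈𝒴} A_i(y)·h₂(α⁽ⁱ⁾(y)) − Σ_{z∈𝒵_i} D_i(z)·h₂(c_i(z)) ≤ ε, where A_i(y) = P(X ≥ i, Y=y)/P(X ≥ i) and D_i(z) = Σ_y A_i(y)·B_i(z|y). Then, with (X,Z,Y) distributed according to P*, the conditional entropies satisfy H(X|Y) − H(X|Z) ≤ (q−1)·ε, where H(X|Y) = Σ_y P_Y(y)·H(P_{X|Y=y}) and H(X|Z) = Σ_{z∈𝒵} P*_Z(z)·H(P*_{X|Z=z}) with P*_Z(z)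 = Σ_{x,y} P*(x,z,y). In particular, if ε = 128·Λ⁻² for an integer Λ ≥ 2, then H(X|Y) − H(X|Z) ≤ 128·(q−1)·Λ⁻². -/
open Finset

/-- The stick-breaking vector on `Fin (n + 1)` with breaking ratios `a`. -/
noncomputable def stickBreak {n : ℕ} (a : Fin n → ℝ) (x : Fin (n + 1)) : ℝ :=
  ∏ i : Fin n, (if x.val = i.val then a i else if i.val < x.val then 1 - a i else 1)

/-- The mass left over before the `i`-th break. -/
noncomputable def stickTail {n : ℕ} (a : Fin n → ℝ) (i : Fin n) : ℝ :=
  ∏ j : Fin n, (if j < i then 1 - a j else 1)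

lemma stickBreak_zero {n : ℕ} (a : Fin (n + 1) → ℝ) : stickBreak a 0 = a 0 := by
  simp [stickBreak, Fin.prod_univ_succ]

lemma stickBreak_succ {n : ℕ} (a : Fin (n + 1) → ℝ) (x : Fin (n + 1)) :
    stickBreak a x.succ = (1 - a 0) * stickBreak (fun i => a i.succ) x := by
  rw [stickBreak, Fin.prod_univ_succ]
  simp only [Fin.val_succ, Fin.val_zero, Nat.succ_ne_zero, if_false, Nat.succ_pos, if_true,
    add_left_inj, add_lt_add_iff_right]
  rfl

lemma stickTail_zero {n : ℕ} (a : Fin (n + 1) → ℝ) : stickTail a 0 = 1 := by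
  simp [stickTail]

lemma stickTail_succ {n : ℕ} (a : Fin (n + 1) → ℝ) (i : Fin n) :
    stickTail a i.succ = (1 - a 0) * stickTail (fun j => a j.succ) i := by
  simp [stickTail, Fin.prod_univ_succ]

lemma sum_stickBreak {n : ℕ} (a : Fin n → ℝ) : ∑ x, stickBreak a x = 1 := by
  induction n with
  | zero => simp [stickBreak]
  | succ n ih =>
    simp [Fin.sum_univ_succ (n := n + 1), stickBreak_zero, stickBreak_succ, ← Finset.mul_sum, ih]

/-- Chain rule for the entropy of a stick-breaking vector. -/
lemma Hent_stickBreak {n : ℕ} (a : Fin n → ℝ) :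
    Hent (stickBreak a) = ∑ i, stickTail a i * h2 (a i) := by
  induction n with
  | zero => simp [Hent, stickBreak]
  | succ n ih =>
    have h := ih (fun i => a i.succ)
    unfold Hent at h ⊢
    rw [Fin.sum_univ_succ, Fin.sum_univ_succ (fun i => stickTail a i * h2 (a i))]
    simp only [stickBreak_zero, stickBreak_succ, stickTail_zero, stickTail_succ,
      Real.negMulLog_mul, Finset.sum_add_distrib, mul_assoc, ← Finset.mul_sum, ← Finset.sum_mul,
      sum_stickBreak, h]
    rw [h2]
    ring

lemma sum_filter_succ_le {n : ℕ} (p : Fin (n + 1) → ℝ) (i : ℕ) :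
    ∑ x ∈ Finset.univ.filter (fun x : Fin (n + 1) => i + 1 ≤ x.val), p x =
      ∑ x ∈ Finset.univ.filter (fun x : Fin n => i ≤ x.val), p x.succ := by
  simp [Finset.sum_filter, Fin.sum_univ_succ]

/-- The conditional probability of `i` given the tail `{x | i ≤ x}` under weights `p`. -/
noncomputable def hazard {n : ℕ} (p : Fin (n + 1) → ℝ) (i : Fin n) : ℝ :=
  p i.castSucc / ∑ x ∈ Finset.univ.filter (fun x : Fin (n + 1) => i.val ≤ x.val), p x

lemma hazard_succ {n : ℕ} (p : Fin (n + 2) → ℝ) (i : Fin n) :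
    hazard p i.succ = hazard (fun x => p x.succ) i := by
  simp only [hazard, Fin.val_succ, sum_filter_succ_le]
  rfl

lemma sum_mul_one_sub_hazard {n : ℕ} (p : Fin (n + 2) → ℝ) (h : ∑ x, p x ≠ 0) :
    (∑ x, p x) * (1 - hazard p 0) = ∑ x : Fin (n + 1), p x.succ := by
  have h0 : hazard p 0 = p 0 / ∑ x, p x := by simp [hazard]
  rw [h0, mul_sub, mul_div_cancel₀ _ h, Fin.sum_univ_succ]
  ring

lemma eq_sum_mul_stickBreak_hazard {n : ℕ} (p : Fin (n + 1) → ℝ)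
    (h : ∀ i : Fin n,
      ∑ x ∈ Finset.univ.filter (fun x : Fin (n + 1) => i.val ≤ x.val), p x ≠ 0)
    (x : Fin (n + 1)) : p x = (∑ x', p x') * stickBreak (hazard p) x := by
  induction n with
  | zero => simp [stickBreak, Fin.fin_one_eq_zero x]
  | succ n ih =>
    have h0 : ∑ x, p x ≠ 0 := by simpa using h 0
    refine Fin.cases ?_ (fun x => ?_) x
    · simp [stickBreak_zero, hazard, mul_div_cancel₀ _ h0]
    · rw [stickBreak_succ, ← mul_assoc, sum_mul_one_sub_hazard p h0]
      simp only [hazard_succ]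
      refine ih (fun x => p x.succ) (fun i => ?_) x
      rw [← sum_filter_succ_le]
      exact h i.succ

lemma tail_eq_sum_mul_stickTail_hazard {n : ℕ} (p : Fin (n + 1) → ℝ)
    (h : ∀ i : Fin n,
      ∑ x ∈ Finset.univ.filter (fun x : Fin (n + 1) => i.val ≤ x.val), p x ≠ 0)
    (i : Fin n) :
    ∑ x ∈ Finset.univ.filter (fun x : Fin (n + 1) => i.val ≤ x.val), p x =
      (∑ x, p x) * stickTail (hazard p) i := by
  induction n with
  | zero => exact i.elim0
  | succ n ih =>
    have h0 : ∑ x, p x ≠ 0 := by simpa using h 0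
    refine Fin.cases ?_ (fun i => ?_) i
    · simp [stickTail_zero]
    · rw [stickTail_succ, ← mul_assoc, sum_mul_one_sub_hazard p h0, Fin.val_succ,
        sum_filter_succ_le]
      simp only [hazard_succ]
      refine ih (fun x => p x.succ) (fun i => ?_) i
      rw [← sum_filter_succ_le]
      exact h i.succ

/-- Weighted entropy of a normalized vector through its hazard ratios. -/
lemma sum_mul_Hent_div_sum {n : ℕ} (p : Fin (n + 1) → ℝ) (h0 : ∑ x, p x ≠ 0)
    (h : ∀ i : Fin n,
      ∑ x ∈ Finset.univ.filter (fun x : Fin (n + 1) => i.val ≤ x.val), p x ≠ 0) :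
    (∑ x, p x) * Hent (fun x => p x / ∑ x', p x') =
      ∑ i : Fin n, (∑ x ∈ Finset.univ.filter (fun x : Fin (n + 1) => i.val ≤ x.val), p x) *
        h2 (hazard p i) := by
  have hp : (fun x => p x / ∑ x', p x') = stickBreak (hazard p) := by
    funext x
    rw [div_eq_iff h0, mul_comm]
    exact eq_sum_mul_stickBreak_hazard p h x
  rw [hp, Hent_stickBreak, Finset.mul_sum]
  refine Finset.sum_congr rfl fun i _ => ?_
  rw [tail_eq_sum_mul_stickTail_hazard p h i, mul_assoc]

/-- Averaging one summand of the chain rule over independent `z i ∼ b i`. -/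
lemma sum_prod_mul_stickTail_mul {n : ℕ} {Z : Fin n → Type*} [∀ i, Fintype (Z i)]
    (b c : (i : Fin n) → Z i → ℝ) (hb : ∀ i, ∑ z, b i z = 1) (f : ℝ → ℝ) (i : Fin n) :
    ∑ z : ((i : Fin n) → Z i),
        (∏ k, b k (z k)) * (stickTail (fun k => c k (z k)) i * f (c i (z i))) =
      stickTail (fun k => ∑ z, b k z * c k z) i * ∑ z, b i z * f (c i z) := by
  classical
  have hl : ∀ z : ((i : Fin n) → Z i),
      (∏ k, b k (z k)) * (stickTail (fun k => c k (z k)) i * f (c i (z i))) =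
        ∏ k, b k (z k) * ((if k < i then 1 - c k (z k) else 1) *
          (if k = i then f (c k (z k)) else 1)) := by
    intro z
    simp only [stickTail, Finset.prod_mul_distrib, Finset.prod_ite_eq', Finset.mem_univ, if_true]
  have hr : stickTail (fun k => ∑ z, b k z * c k z) i * ∑ z, b i z * f (c i z) =
      ∏ k, ((if k < i then 1 - ∑ z, b k z * c k z else 1) *
        (if k = i then ∑ z, b k z * f (c k z) else 1)) := by
    simp only [stickTail, Finset.prod_mul_distrib, Finset.prod_ite_eq', Finset.mem_univ, if_true]
  rw [hr]
  simp only [hl]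
  rw [← Fintype.prod_sum (fun k z => b k z * ((if k < i then 1 - c k z else 1) *
          (if k = i then f (c k z) else 1)))]
  refine Finset.prod_congr rfl fun k _ => ?_
  rcases lt_trichotomy k i with hk | hk | hk
  · simp [hk, hk.ne, mul_sub, hb]
  · simp [hk]
  · simp [hk.not_gt, hk.ne', hb]

/-- Weighted entropy of a stick-breaking vector scaled by `g`, also when `g = 0`. -/
lemma sum_mul_Hent_mul_stickBreak_div {n : ℕ} (g : ℝ) (a : Fin n → ℝ) :
    (∑ x, g * stickBreak a x) * Hent (fun x => g * stickBreak a x / ∑ x', g * stickBreak a x') =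
      g * ∑ i, stickTail a i * h2 (a i) := by
  rw [← Finset.mul_sum, sum_stickBreak, mul_one, ← Hent_stickBreak]
  rcases eq_or_ne g 0 with rfl | hg
  · simp
  · simp [mul_div_cancel_left₀ _ hg]

lemma sum_Pstar {n : ℕ} {Y : Type*} [Fintype Y] {Z : Fin n → Type*}
    (P : Fin (n + 1) → Y → ℝ) (B : (i : Fin n) → Y → Z i → ℝ)
    (c : (i : Fin n) → Z i → ℝ) (x : Fin (n + 1)) (z : (i : Fin n) → Z i) :
    ∑ y, Pstar (q := n + 1) P B c x z y =
      (∑ y, (∑ x', P x' y) * ∏ i, B i y (z i)) * stickBreak (fun i => c i (z i)) x := by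
  rw [Finset.sum_mul]
  rfl

/-- The conditional entropy of `X` given `Z`, decomposed along the one-hot components. -/
lemma condEntropy_Pstar {n : ℕ} {Y : Type*} [Fintype Y] {Z : Fin n → Type*}
    [∀ i, Fintype (Z i)] (P : Fin (n + 1) → Y → ℝ) (B : (i : Fin n) → Y → Z i → ℝ)
    (c : (i : Fin n) → Z i → ℝ)
    (hpos : ∀ (i : Fin n) (y : Y),
      ∑ x ∈ Finset.univ.filter (fun x : Fin (n + 1) => i.val ≤ x.val), P x y ≠ 0)
    (hB1 : ∀ i y, ∑ z, B i y z = 1)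
    (hmatch : ∀ i y, ∑ z, B i y z * c i z = hazard (fun x => P x y) i) :
    (∑ z : ((i : Fin n) → Z i),
        (∑ x, ∑ y, Pstar (q := n + 1) P B c x z y) *
          Hent (fun x => (∑ y, Pstar (q := n + 1) P B c x z y) /
            (∑ x', ∑ y, Pstar (q := n + 1) P B c x' z y))) =
      ∑ i : Fin n, ∑ y,
        (∑ x ∈ Finset.univ.filter (fun x : Fin (n + 1) => i.val ≤ x.val), P x y) *
          ∑ z, B i y z * h2 (c i z) := by
  simp only [sum_Pstar, sum_mul_Hent_mul_stickBreak_div]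
  refine (Finset.sum_congr rfl fun z _ => Finset.sum_mul_sum _ _ _ _).trans ?_
  rw [Finset.sum_comm, Finset.sum_comm (s := (Finset.univ : Finset (Fin n)))]
  refine Finset.sum_congr rfl fun y _ => ?_
  rw [Finset.sum_comm]
  refine Finset.sum_congr rfl fun i _ => ?_
  simp only [mul_assoc]
  rw [← Finset.mul_sum, sum_prod_mul_stickTail_mul (fun k => B k y) c (fun k => hB1 k y),
    tail_eq_sum_mul_stickTail_hazard (fun x => P x y) (fun i => hpos i y) i, mul_assoc]
  simp only [hmatch]

/-- Upgrading cost of the one-hot construction: if each binary component loses at most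
`ε` of conditional entropy, i.e. `Σ_y A_i(y)·h₂(α⁽ⁱ⁾(y)) − Σ_z D_i(z)·h₂(c_i(z)) ≤ ε`
with `A_i(y) = P(X≥i, Y=y)/P(X≥i)` and `D_i(z) = Σ_y A_i(y)·B_i(z|y)`, then with
`(X,Z,Y) ∼ P*` we have `H(X|Y) − H(X|Z) ≤ (q−1)·ε`. -/
theorem onehot_upgrading_cost {q : ℕ} (hq : 2 ≤ q) {Y : Type*} [Fintype Y]
    {Z : Fin (q - 1) → Type*} [∀ i, Fintype (Z i)]
    (P : Fin q → Y → ℝ)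
    (B : (i : Fin (q - 1)) → Y → Z i → ℝ)
    (c : (i : Fin (q - 1)) → Z i → ℝ)
    (hP0 : ∀ x y, 0 ≤ P x y)
    (hP1 : ∑ x : Fin q, ∑ y : Y, P x y = 1)
    (hpos : ∀ (i : Fin (q - 1)) (y : Y),
      0 < ∑ x ∈ Finset.univ.filter (fun x : Fin q => i.val ≤ x.val), P x y)
    (hB0 : ∀ (i : Fin (q - 1)) (y : Y) (z : Z i), 0 ≤ B i y z)
    (hB1 : ∀ (i : Fin (q - 1)) (y : Y), ∑ z : Z i, B i y z = 1)
    (hc : ∀ (i : Fin (q - 1)) (z : Z i), 0 ≤ c i z ∧ c i z ≤ 1)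
    (hmatch : ∀ (i : Fin (q - 1)) (y : Y),
      ∑ z : Z i, B i y z * c i z =
        P ⟨i.val, by have := i.isLt; omega⟩ y /
          ∑ x ∈ Finset.univ.filter (fun x : Fin q => i.val ≤ x.val), P x y)
    (ε : ℝ) (hε0 : 0 ≤ ε)
    (hε : ∀ i : Fin (q - 1),
      (∑ y : Y,
          ((∑ x ∈ Finset.univ.filter (fun x : Fin q => i.val ≤ x.val), P x y) /
              (∑ y' : Y, ∑ x ∈ Finset.univ.filter (fun x : Fin q => i.val ≤ x.val), P x y')) *
            h2 (P ⟨i.val, by have := i.isLt; omega⟩ y /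
              ∑ x ∈ Finset.univ.filter (fun x : Fin q => i.val ≤ x.val), P x y))
        - (∑ z : Z i,
            (∑ y : Y,
              ((∑ x ∈ Finset.univ.filter (fun x : Fin q => i.val ≤ x.val), P x y) /
                  (∑ y' : Y, ∑ x ∈ Finset.univ.filter (fun x : Fin q => i.val ≤ x.val), P x y')) *
                B i y z) * h2 (c i z)) ≤ ε) :
    (∑ y : Y, (∑ x : Fin q, P x y) * Hent (fun x => P x y / ∑ x' : Fin q, P x' y))
      - (∑ z : ((i : Fin (q - 1)) → Z i),
          (∑ x : Fin q, ∑ y : Y, Pstar P B c x z y) *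
            Hent (fun x => (∑ y : Y, Pstar P B c x z y) /
              (∑ x' : Fin q, ∑ y : Y, Pstar P B c x' z y)))
      ≤ ((q : ℝ) - 1) * ε := by
  obtain ⟨n, rfl⟩ : ∃ n, q = n + 1 := ⟨q - 1, by omega⟩
  have hne : ∀ (i : Fin n) (y : Y),
      ∑ x ∈ Finset.univ.filter (fun x : Fin (n + 1) => i.val ≤ x.val), P x y ≠ 0 :=
    fun i y => (hpos i y).ne'
  have hPY : ∀ y, ∑ x, P x y ≠ 0 := fun y => by
    simpa using hne ⟨0, by omega⟩ y
  have hXY : (∑ y, (∑ x, P x y) * Hent (fun x => P x y / ∑ x', P x' y)) =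
      ∑ i : Fin n, ∑ y,
        (∑ x ∈ Finset.univ.filter (fun x : Fin (n + 1) => i.val ≤ x.val), P x y) *
          h2 (hazard (fun x => P x y) i) := by
    rw [Finset.sum_comm]
    exact Finset.sum_congr rfl fun y _ =>
      sum_mul_Hent_div_sum (fun x => P x y) (hPY y) fun i => hne i y
  have hXZ := condEntropy_Pstar (n := n) P B c hne hB1 hmatch
  have hY : Nonempty Y := by
    by_contra hY
    rw [not_nonempty_iff] at hY
    simp at hP1
  have key : ∀ i : Fin n,
      (∑ y, (∑ x ∈ Finset.univ.filter (fun x : Fin (n + 1) => i.val ≤ x.val), P x y) *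
          h2 (hazard (fun x => P x y) i)) -
        (∑ y, (∑ x ∈ Finset.univ.filter (fun x : Fin (n + 1) => i.val ≤ x.val), P x y) *
          ∑ z, B i y z * h2 (c i z)) ≤ ε := by
    intro i
    set T : Y → ℝ := fun y =>
      ∑ x ∈ Finset.univ.filter (fun x : Fin (n + 1) => i.val ≤ x.val), P x y with hT
    have hS : 0 < ∑ y, T y := Finset.sum_pos (fun y _ => hpos i y) Finset.univ_nonempty
    have hS1 : ∑ y, T y ≤ 1 := by
      rw [← hP1, Finset.sum_comm (s := (Finset.univ : Finset (Fin (n + 1))))]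
      refine Finset.sum_le_sum fun y _ => ?_
      exact Finset.sum_le_sum_of_subset_of_nonneg (Finset.filter_subset _ _) fun x _ _ => hP0 x y
    have hi : (∑ y, T y / (∑ y', T y') * h2 (hazard (fun x => P x y) i)) -
        ∑ z, (∑ y, T y / (∑ y', T y') * B i y z) * h2 (c i z) ≤ ε := hε i
    have hswap : ∑ z, (∑ y, T y / (∑ y', T y') * B i y z) * h2 (c i z) =
        (∑ y, T y * ∑ z, B i y z * h2 (c i z)) / ∑ y', T y' := by
      simp only [Finset.sum_mul, Finset.mul_sum, Finset.sum_div]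
      rw [Finset.sum_comm]
      exact Finset.sum_congr rfl fun y _ => Finset.sum_congr rfl fun z _ => by ring
    have hpull : ∑ y, T y / (∑ y', T y') * h2 (hazard (fun x => P x y) i) =
        (∑ y, T y * h2 (hazard (fun x => P x y) i)) / ∑ y', T y' := by
      rw [Finset.sum_div]
      exact Finset.sum_congr rfl fun y _ => by ring
    rw [hswap, hpull, ← sub_div, div_le_iff₀ hS] at hi
    exact hi.trans (mul_le_of_le_one_right hε0 hS1)
  calc _ = ∑ i : Fin n, _ := (congrArg₂ (· - ·) hXY hXZ).trans (Finset.sum_sub_distrib _ _).symm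
    _ ≤ ∑ _i : Fin n, ε := Finset.sum_le_sum fun i _ => key i
    _ = _ := by simp
end

section
/- For all 0 ≤ p₀ ≤ p₁ ≤ 1 and all α ∈ [0,1]: h₂(α·p₀ + (1−α)·p₁) − α·h₂(p₀) − (1−α)·h₂(p₁) ≤ p₁ − p₀; moreover, if min{p₀, 1−p₁} > 0, then also h₂(α·p₀ + (1−α)·p₁) − α·h₂(p₀) − (1−α)·h₂(p₁) ≤ (p₁−p₀)²/(2·min{p₀, 1−p₁}). -/
/-- Upper bound on `x log x` from `log (x / m) ≤ x / m - 1`. -/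
lemma neg_negMulLog_le_s5 {x m : ℝ} (hx : 0 ≤ x) (hm : 0 < m) :
    -Real.negMulLog x ≤ x * Real.log m + x * (x / m - 1) := by
  rcases hx.eq_or_lt with rfl | hx
  · simp
  · have h := Real.log_le_sub_one_of_pos (div_pos hx hm)
    rw [Real.log_div hx.ne' hm.ne'] at h
    have := mul_le_mul_of_nonneg_left h hx.le
    rw [Real.negMulLog]
    linarith

/-- The binary relative entropy is at most the chi-squared divergence. -/
lemma neg_h2_le {p m : ℝ} (hp0 : 0 ≤ p) (hp1 : p ≤ 1) (hm0 : 0 < m) (hm1 : m < 1) :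
    -h2 p ≤ p * Real.log m + (1 - p) * Real.log (1 - m) + (p - m) ^ 2 / (m * (1 - m)) := by
  have hm1' : 0 < 1 - m := sub_pos.2 hm1
  have h := add_le_add (neg_negMulLog_le_s5 hp0 hm0) (neg_negMulLog_le_s5 (sub_nonneg.2 hp1) hm1')
  have e : (p - m) ^ 2 / (m * (1 - m)) =
      p * (p / m - 1) + (1 - p) * ((1 - p) / (1 - m) - 1) := by
    field_simp
    ring
  rw [h2, e]
  linarith

/-- The concavity gap of `h2` is at most the averaged chi-squared divergence. -/
lemma h2_gap_le_chiSq {p₀ p₁ α : ℝ} (h0 : 0 ≤ p₀) (h01 : p₀ < p₁) (h1 : p₁ ≤ 1)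
    (hα0 : 0 < α) (hα1 : α < 1) {m : ℝ} (hm : m = α * p₀ + (1 - α) * p₁)
    (hm0 : 0 < m) (hm1 : m < 1) :
    h2 m - α * h2 p₀ - (1 - α) * h2 p₁ ≤ α * (1 - α) * (p₁ - p₀) ^ 2 / (m * (1 - m)) := by
  have a := mul_le_mul_of_nonneg_left (neg_h2_le h0 (h01.le.trans h1) hm0 hm1) hα0.le
  have b := mul_le_mul_of_nonneg_left (neg_h2_le (h0.trans h01.le) h1 hm0 hm1)
    (sub_nonneg.2 hα1.le)
  have e : α * (1 - α) * (p₁ - p₀) ^ 2 / (m * (1 - m)) =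
      α * ((p₀ - m) ^ 2 / (m * (1 - m))) + (1 - α) * ((p₁ - m) ^ 2 / (m * (1 - m))) := by
    rw [← mul_div_assoc, ← mul_div_assoc, ← add_div]
    congr 1
    rw [hm]
    ring
  have hlog : h2 m = -(α * (p₀ * Real.log m + (1 - p₀) * Real.log (1 - m)) +
      (1 - α) * (p₁ * Real.log m + (1 - p₁) * Real.log (1 - m))) := by
    rw [h2, Real.negMulLog, Real.negMulLog]
    linear_combination (Real.log (1 - m) - Real.log m) * hm
  rw [e, hlog]
  linarith

/-- Bounds on the concavity gap of the binary entropy function: for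
`0 ≤ p₀ ≤ p₁ ≤ 1` and `α ∈ [0,1]`, the gap is at most `p₁ − p₀`, and, when
`min{p₀, 1−p₁} > 0`, also at most `(p₁−p₀)²/(2·min{p₀, 1−p₁})`. -/
theorem h2_concavity_gap_bounds (p₀ p₁ α : ℝ)
    (h0 : 0 ≤ p₀) (h01 : p₀ ≤ p₁) (h1 : p₁ ≤ 1)
    (hα0 : 0 ≤ α) (hα1 : α ≤ 1) :
    (h2 (α * p₀ + (1 - α) * p₁) - α * h2 p₀ - (1 - α) * h2 p₁ ≤ p₁ - p₀) ∧
    (0 < min p₀ (1 - p₁) →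
      h2 (α * p₀ + (1 - α) * p₁) - α * h2 p₀ - (1 - α) * h2 p₁
        ≤ (p₁ - p₀) ^ 2 / (2 * min p₀ (1 - p₁))) := by
  have hd : 0 ≤ p₁ - p₀ := sub_nonneg.2 h01
  by_cases hdeg : α = 0 ∨ α = 1 ∨ p₀ = p₁
  · have hgap : h2 (α * p₀ + (1 - α) * p₁) - α * h2 p₀ - (1 - α) * h2 p₁ = 0 := by
      rcases hdeg with rfl | rfl | rfl
      · simp
      · simp
      · rw [← add_mul, add_sub_cancel, one_mul]
        ring
    rw [hgap]
    exact ⟨hd, fun hq => by positivity⟩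
  · push Not at hdeg
    obtain ⟨hα0', hα1', hne⟩ := hdeg
    replace hα0 : 0 < α := lt_of_le_of_ne hα0 hα0'.symm
    replace hα1 : α < 1 := lt_of_le_of_ne hα1 hα1'
    replace h01 : p₀ < p₁ := lt_of_le_of_ne h01 hne
    replace hd : 0 < p₁ - p₀ := sub_pos.2 h01
    have hβ : 0 < 1 - α := sub_pos.2 hα1
    obtain ⟨m, hm⟩ : ∃ m, m = α * p₀ + (1 - α) * p₁ := ⟨_, rfl⟩
    have hmp : m = p₀ + (1 - α) * (p₁ - p₀) := by rw [hm]; ring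
    have hmq : 1 - m = (1 - p₁) + α * (p₁ - p₀) := by rw [hm]; ring
    have hβd := mul_pos hβ hd
    have hαd := mul_pos hα0 hd
    have hm0 : 0 < m := by linarith
    have hm1 : 0 < 1 - m := by linarith
    have hmm := mul_pos hm0 hm1
    have hgap := h2_gap_le_chiSq h0 h01 h1 hα0 hα1 hm hm0 (sub_pos.1 hm1)
    rw [← hm]
    refine ⟨hgap.trans ?_, fun hq => hgap.trans ?_⟩
    · rw [div_le_iff₀ hmm]
      have key : α * (1 - α) * (p₁ - p₀) ≤ m * (1 - m) := by
        rw [hmp]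
        nlinarith [mul_nonneg h0 (sub_nonneg.2 h1), mul_nonneg h0 hαd.le,
          mul_nonneg (sub_nonneg.2 h1) hβd.le, mul_pos hβd hαd]
      nlinarith [mul_le_mul_of_nonneg_left key hd.le]
    · obtain ⟨q, hqdef⟩ : ∃ q, q = min p₀ (1 - p₁) := ⟨_, rfl⟩
      rw [← hqdef] at hq ⊢
      have hq0 : q ≤ m := by linarith [hqdef.le.trans (min_le_left _ _)]
      have hq1 : q ≤ 1 - m := by linarith [hqdef.le.trans (min_le_right _ _)]
      have hmq2 : q ≤ 2 * (m * (1 - m)) := by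
        nlinarith [mul_nonneg (sub_nonneg.2 hq0) (sub_nonneg.2 hq1)]
      have hαβ : 4 * (α * (1 - α)) ≤ 1 := by nlinarith [sq_nonneg (2 * α - 1)]
      have key : α * (1 - α) * (2 * q) ≤ m * (1 - m) := by
        nlinarith [mul_le_mul_of_nonneg_right hαβ hq.le]
      rw [div_le_div_iff₀ hmm (by positivity)]
      nlinarith [mul_le_mul_of_nonneg_left key (sq_nonneg (p₁ - p₀))]
end

section
/- Let n ≥ 1 be an integer and let 0 ≤ p₀ ≤ p₁ ≤ ⋯ ≤ p_n ≤ 1. Then there exists an index i ∈ {1,…,n} such that for every α ∈ [0,1], h₂(α·p_{i−1} + (1−α)·p_i) − α·h₂(p_{i−1}) − (1−α)·h₂(p_i) ≤ 8/(n+1)². -/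
open Real in
/-- The tangent-line bound `log x ≤ x - 1` at `x = p / m`. -/
lemma negMulLog_ge_of_pos {p m : ℝ} (hp : 0 ≤ p) (hm : 0 < m) :
    -p * log m - p ^ 2 / m + p ≤ negMulLog p := by
  rcases hp.eq_or_lt with rfl | hp
  · simp
  · have h := mul_le_mul_of_nonneg_left (log_le_sub_one_of_pos (div_pos hp hm)) hp.le
    rw [log_div hp.ne' hm.ne'] at h
    have h' : p * (p / m - 1) = p ^ 2 / m - p := by ring
    unfold negMulLog
    linarith

open Real in
/-- The Jensen gap of `negMulLog` is at most the corresponding `χ²` gap. -/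
lemma negMulLog_gap_le {p q α β : ℝ} (hp : 0 ≤ p) (hq : 0 ≤ q) (hα : 0 ≤ α) (hβ : 0 ≤ β)
    (hαβ : α + β = 1) (hm : 0 < α * p + β * q) :
    negMulLog (α * p + β * q) - α * negMulLog p - β * negMulLog q
      ≤ α * β * (p - q) ^ 2 / (α * p + β * q) := by
  have hpm := mul_le_mul_of_nonneg_left (negMulLog_ge_of_pos hp hm) hα
  have hqm := mul_le_mul_of_nonneg_left (negMulLog_ge_of_pos hq hm) hβ
  have hchi : α * β * (p - q) ^ 2 / (α * p + β * q)
      = α * (p ^ 2 / (α * p + β * q)) + β * (q ^ 2 / (α * p + β * q)) - (α * p + β * q) := by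
    obtain rfl : β = 1 - α := by linarith
    field_simp
    ring
  have hlog : negMulLog (α * p + β * q) = -(α * p + β * q) * log (α * p + β * q) := rfl
  rw [hchi, hlog]
  linarith

open Real in
/-- In the angular coordinate `p = sin² a`, the Jensen gap of `h2` is at most `sin² (b - a)`. -/
lemma h2_gap_le_sin_sq (a b : ℝ) {α β : ℝ} (hα : 0 ≤ α) (hβ : 0 ≤ β) (hαβ : α + β = 1) :
    h2 (α * sin a ^ 2 + β * sin b ^ 2) - α * h2 (sin a ^ 2) - β * h2 (sin b ^ 2)
      ≤ sin (b - a) ^ 2 := by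
  have hcompl : 1 - (α * sin a ^ 2 + β * sin b ^ 2) = α * cos a ^ 2 + β * cos b ^ 2 := by
    rw [cos_sq', cos_sq']
    linear_combination -hαβ
  have hgap : h2 (α * sin a ^ 2 + β * sin b ^ 2) - α * h2 (sin a ^ 2) - β * h2 (sin b ^ 2)
      = (negMulLog (α * sin a ^ 2 + β * sin b ^ 2)
          - α * negMulLog (sin a ^ 2) - β * negMulLog (sin b ^ 2))
        + (negMulLog (α * cos a ^ 2 + β * cos b ^ 2)
          - α * negMulLog (cos a ^ 2) - β * negMulLog (cos b ^ 2)) := by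
    simp only [h2, hcompl, ← cos_sq']
    ring
  rcases hα.eq_or_lt with rfl | hα'
  · obtain rfl : β = 1 := by linarith
    simpa using sq_nonneg _
  rcases hβ.eq_or_lt with rfl | hβ'
  · obtain rfl : α = 1 := by linarith
    simpa using sq_nonneg _
  have hs : 0 ≤ α * sin a ^ 2 + β * sin b ^ 2 := by positivity
  have hc : 0 ≤ α * cos a ^ 2 + β * cos b ^ 2 := by positivity
  rcases hs.eq_or_lt with hs0 | hs
  · have ha : sin a ^ 2 = 0 := by nlinarith [sq_nonneg (sin a), sq_nonneg (sin b)]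
    have hb : sin b ^ 2 = 0 := by nlinarith [sq_nonneg (sin a), sq_nonneg (sin b)]
    simpa [ha, hb, h2] using sq_nonneg _
  rcases hc.eq_or_lt with hc0 | hc
  · have ha : cos a ^ 2 = 0 := by nlinarith [sq_nonneg (cos a), sq_nonneg (cos b)]
    have hb : cos b ^ 2 = 0 := by nlinarith [sq_nonneg (cos a), sq_nonneg (cos b)]
    rw [hgap, sin_sq a, sin_sq b, ha, hb]
    simpa [hαβ] using sq_nonneg (sin (b - a))
  have h₁ := negMulLog_gap_le (sq_nonneg (sin a)) (sq_nonneg (sin b)) hα hβ hαβ hs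
  have h₂ := negMulLog_gap_le (sq_nonneg (cos a)) (sq_nonneg (cos b)) hα hβ hαβ hc
  have hcos : (cos a ^ 2 - cos b ^ 2) ^ 2 = (sin a ^ 2 - sin b ^ 2) ^ 2 := by
    rw [cos_sq', cos_sq']
    ring
  rw [hcos] at h₂
  rw [hgap]
  refine (add_le_add h₁ h₂).trans ?_
  rw [div_add_div _ _ hs.ne' hc.ne', div_le_iff₀ (mul_pos hs hc),
    mul_comm (α * sin a ^ 2 + β * sin b ^ 2) (α * β * _), ← mul_add, add_comm (α * cos a ^ 2 + _),
    ← hcompl, add_sub_cancel, mul_one, hcompl]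
  have hfac : sin a ^ 2 - sin b ^ 2
      = -sin (b - a) * (sin a * cos b + sin b * cos a) := by
    rw [sin_sub]
    linear_combination sin b ^ 2 * sin_sq_add_cos_sq a - sin a ^ 2 * sin_sq_add_cos_sq b
  rw [hfac]
  linarith [mul_nonneg (sq_nonneg (sin (b - a)))
    (sq_nonneg (α * sin a * cos a - β * sin b * cos b))]

/-- Sphere-packing in the simplex of Bernoulli distributions: given
`0 ≤ p₀ ≤ p₁ ≤ ⋯ ≤ p_n ≤ 1` (`n ≥ 1`), there is an index `i ∈ {1,…,n}` such that for
every `α ∈ [0,1]` the concavity gap of `h₂` at `(p_{i-1}, p_i)` is at most `8/(n+1)²`. -/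
theorem h2_sphere_packing (n : ℕ) (hn : 1 ≤ n) (p : ℕ → ℝ)
    (hp : ∀ i ≤ n, 0 ≤ p i ∧ p i ≤ 1)
    (hmono : ∀ i < n, p i ≤ p (i + 1)) :
    ∃ i, 1 ≤ i ∧ i ≤ n ∧ ∀ α : ℝ, 0 ≤ α → α ≤ 1 →
      h2 (α * p (i - 1) + (1 - α) * p i) - α * h2 (p (i - 1)) - (1 - α) * h2 (p i)
        ≤ 8 / ((n : ℝ) + 1) ^ 2 := by
  set θ : ℕ → ℝ := fun i => Real.arcsin √(p i) with hθ
  have hsin : ∀ i ≤ n, Real.sin (θ i) ^ 2 = p i := fun i hi => by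
    rw [hθ, Real.sin_arcsin (by linarith [Real.sqrt_nonneg (p i)])
      (Real.sqrt_le_one.mpr (hp i hi).2), Real.sq_sqrt (hp i hi).1]
  have hn0 : (0 : ℝ) < n := by exact_mod_cast hn
  obtain ⟨i, hi, hgap⟩ : ∃ i ∈ Finset.range n, θ (i + 1) - θ i ≤ Real.pi / 2 / n := by
    refine Finset.exists_le_of_sum_le (Finset.nonempty_range_iff.mpr (by omega)) ?_
    rw [Finset.sum_range_sub, Finset.sum_const, Finset.card_range, nsmul_eq_mul,
      mul_div_cancel₀ _ hn0.ne']
    linarith [Real.arcsin_le_pi_div_two √(p n), Real.arcsin_nonneg.mpr (Real.sqrt_nonneg (p 0))]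
  rw [Finset.mem_range] at hi
  refine ⟨i + 1, by omega, by omega, fun α hα0 hα1 => ?_⟩
  have h := h2_gap_le_sin_sq (θ i) (θ (i + 1)) hα0 (sub_nonneg.mpr hα1) (by ring)
  rw [hsin i hi.le, hsin (i + 1) hi] at h
  rw [Nat.add_sub_cancel]
  refine h.trans ?_
  rcases hn.eq_or_lt with rfl | hn2
  · refine (Real.sin_sq_le_one _).trans ?_
    norm_num
  · have hθmono : 0 ≤ θ (i + 1) - θ i :=
      sub_nonneg.mpr (Real.monotone_arcsin (Real.sqrt_le_sqrt (hmono i hi)))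
    have hn2' : (2 : ℝ) ≤ n := by exact_mod_cast hn2
    calc Real.sin (θ (i + 1) - θ i) ^ 2 ≤ (θ (i + 1) - θ i) ^ 2 :=
          sq_le_sq.mpr (Real.abs_sin_le_abs)
      _ ≤ (Real.pi / 2 / n) ^ 2 := pow_le_pow_left₀ hθmono hgap 2
      _ ≤ (8 / 3 / ((n : ℝ) + 1)) ^ 2 := by
          refine pow_le_pow_left₀ (by positivity) ?_ 2
          rw [div_le_div_iff₀ hn0 (by positivity)]
          nlinarith [Real.pi_lt_d2]
      _ ≤ 8 / ((n : ℝ) + 1) ^ 2 := by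
          rw [div_pow]
          gcongr
          norm_num
end

section
/- Let n ≥ 3, let w : {1,…,n} → ℝ be a probability vector (w_y ≥ 0, Σ_y w_y = 1), let p : {1,…,n} → [0,1], let i ∈ {2,…,n−1}, and let α ∈ [0,1] satisfy α·p_{i−1} + (1−α)·p_{i+1} = p_i. Define the split kernel Q : {1,…,n} → {1,…,n}∖{i} by Q(z|y) = 1_{z=y} for y ≠ i, Q(i−1|i) = α, Q(i+1|i) = 1−α, and define w' on {1,…,n}∖{i} by w'_{i−1} = w_{i−1} + α·w_i, w'_{i+1} = w_{i+1} + (1−α)·w_i, and w'_z = w_z otherwise. Then: (a) Σ_{z≠i} Q(z|y)·p_z = p_y for every y ∈ {1,…,n}, so the split produces a Markov chain X−Z−Y whose (X,Y)-marginal equals the original joint distribution; and (b) Σ_{y=1}^{n} w_y·h₂(p_y) − Σ_{z≠i} w'_z·h₂(p_z) = w_i·[h₂(α·p_{i−1}+(1−α)·p_{i+1}) − α·h₂(p_{i−1}) − (1−α)·h₂(p_{i+1})]; this quantity equals I(X;Z) − I(X;Y) for the split distribution. -/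
open Finset

/-- A sum against a function supported on two distinct points of `s`. -/
theorem sum_two_point_mul {ι : Type*} [DecidableEq ι] (s : Finset ι) {j k : ι} (hj : j ∈ s)
    (hk : k ∈ s) (hjk : j ≠ k) (a b : ℝ) (f : ι → ℝ) :
    ∑ z ∈ s, (if z = j then a else if z = k then b else 0) * f z = a * f j + b * f k := by
  rw [Finset.sum_eq_add_of_mem j k hj hk hjk
    (fun z _ hz => by rw [if_neg hz.1, if_neg hz.2, zero_mul]),
    if_pos rfl, if_neg hjk.symm, if_pos rfl]

/-- Splitting the `i`-th output symbol into its neighbors. With `Y` on `{1,…,n}` having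
law `w` and posteriors `p`, `i ∈ {2,…,n−1}`, `α ∈ [0,1]` with
`α·p_{i−1} + (1−α)·p_{i+1} = p_i`, the split kernel `Q` and the new law `w'`:
(a) the split reproduces the original channel (Markov chain `X−Z−Y` with the same
`(X,Y)`-marginal), and (b) the loss in conditional entropy, i.e. `I(X;Z) − I(X;Y)`,
equals `w_i·[h₂(α·p_{i−1}+(1−α)·p_{i+1}) − α·h₂(p_{i−1}) − (1−α)·h₂(p_{i+1})]`. -/
theorem cost_of_split (n : ℕ) (hn : 3 ≤ n) (w p : ℕ → ℝ)
    (hw0 : ∀ y ∈ Finset.Icc 1 n, 0 ≤ w y) (hw1 : ∑ y ∈ Finset.Icc 1 n, w y = 1)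
    (hp : ∀ y ∈ Finset.Icc 1 n, 0 ≤ p y ∧ p y ≤ 1)
    (i : ℕ) (hi1 : 2 ≤ i) (hi2 : i ≤ n - 1)
    (α : ℝ) (hα0 : 0 ≤ α) (hα1 : α ≤ 1)
    (hαp : α * p (i - 1) + (1 - α) * p (i + 1) = p i)
    (Q : ℕ → ℕ → ℝ)
    (hQ : ∀ y z, Q y z =
      if y ≠ i then (if z = y then 1 else 0)
      else (if z = i - 1 then α else if z = i + 1 then 1 - α else 0))
    (w' : ℕ → ℝ)
    (hw' : ∀ z, w' z =
      if z = i - 1 then w (i - 1) + α * w i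
      else if z = i + 1 then w (i + 1) + (1 - α) * w i else w z) :
    (∀ y ∈ Finset.Icc 1 n, ∑ z ∈ (Finset.Icc 1 n).erase i, Q y z * p z = p y) ∧
    (∑ y ∈ Finset.Icc 1 n, w y * h2 (p y))
        - (∑ z ∈ (Finset.Icc 1 n).erase i, w' z * h2 (p z))
      = w i * (h2 (α * p (i - 1) + (1 - α) * p (i + 1))
          - α * h2 (p (i - 1)) - (1 - α) * h2 (p (i + 1))) := by
  have hmem : i ∈ Finset.Icc 1 n := Finset.mem_Icc.2 (by omega)
  have hprev : i - 1 ∈ (Finset.Icc 1 n).erase i := by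
    rw [Finset.mem_erase, Finset.mem_Icc]; omega
  have hnext : i + 1 ∈ (Finset.Icc 1 n).erase i := by
    rw [Finset.mem_erase, Finset.mem_Icc]; omega
  have hsplit (f : ℕ → ℝ) : ∑ z ∈ (Finset.Icc 1 n).erase i, Q i z * f z
      = α * f (i - 1) + (1 - α) * f (i + 1) := by
    simpa [hQ] using sum_two_point_mul _ hprev hnext (by omega) α (1 - α) f
  have hw'Q (z : ℕ) : w' z = w z + w i * Q i z := by
    rw [hw', hQ, if_neg (not_not.2 rfl)]
    split_ifs with hprev_eq hnext_eq
    · subst hprev_eq; ring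
    · subst hnext_eq; ring
    · ring
  refine ⟨fun y hy => ?_, ?_⟩
  · by_cases hyi : y = i
    · rw [hyi, hsplit p, hαp]
    · simp [hQ, hyi, Finset.mem_Icc.1 hy]
  · simp only [hw'Q, add_mul, mul_assoc]
    rw [Finset.sum_add_distrib, ← Finset.mul_sum, hsplit (fun z => h2 (p z)),
      ← Finset.add_sum_erase _ _ hmem, hαp]
    ring
end

section
/- Let n ≥ 3, let w : {1,…,n} → ℝ be a probability vector (w_y ≥ 0, Σ_y w_y = 1), and let p₁ ≤ p₂ ≤ ⋯ ≤ p_n be numbers in [0,1]. Then there exist i ∈ {2,…,n−1} and α ∈ [0,1] with α·p_{i−1} + (1−α)·p_{i+1} = p_i such that w_i·[h₂(p_i) − α·h₂(p_{i−1}) − (1−α)·h₂(p_{i+1})] ≤ 256/n³. (That is, the i-th output symbol can be split into its neighbors at a mutual-information cost I(X;Z) − I(X;Y) of at most 256/|𝒴|³.) -/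
open Finset

/-- The `negMulLog` Jensen gap at `q` is at most the corresponding chi-square divergence. -/
lemma negMulLog_jensen_gap_le {x q y α : ℝ} (hx : 0 ≤ x) (hq : 0 < q) (hy : 0 ≤ y)
    (h0 : 0 ≤ α) (h1 : α ≤ 1) (h : α * x + (1 - α) * y = q) :
    Real.negMulLog q - α * Real.negMulLog x - (1 - α) * Real.negMulLog y
      ≤ (q - x) * (y - q) / q := by
  have tangent : ∀ z : ℝ, 0 ≤ z → -z * Real.log q - z * (z - q) / q ≤ Real.negMulLog z := by
    intro z hz
    rcases hz.eq_or_lt with rfl | hz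
    · simp
    have hlog := Real.log_le_sub_one_of_pos (div_pos hz hq)
    rw [Real.log_div hz.ne' hq.ne'] at hlog
    have hmul := mul_le_mul_of_nonneg_left hlog hz.le
    have hdiv : z * (z / q - 1) = z * (z - q) / q := by field_simp
    rw [Real.negMulLog]
    linarith
  have hX := mul_le_mul_of_nonneg_left (tangent x hx) h0
  have hY := mul_le_mul_of_nonneg_left (tangent y hy) (sub_nonneg.2 h1)
  have hlin : (α * x + (1 - α) * y) * Real.log q = q * Real.log q := by rw [h]
  have hquad : α * (x * (x - q) / q) + (1 - α) * (y * (y - q) / q)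
      = (q - x) * (y - q) / q := by
    field_simp
    linear_combination (x + y - q) * h
  rw [show Real.negMulLog q = -q * Real.log q from rfl]
  linarith

lemma sub_mul_sub_div_le_sqrt {x q y : ℝ} (hx : 0 ≤ x) (hxq : x ≤ q) (hqy : q ≤ y)
    (hq : 0 < q) : (q - x) * (y - q) / q ≤ 2 * (√y - √x) ^ 2 := by
  have hs : 0 < √q := Real.sqrt_pos.2 hq
  have hxs := Real.sqrt_le_sqrt hxq
  have hsy := Real.sqrt_le_sqrt hqy
  have hx0 := Real.sqrt_nonneg x
  have ex := Real.sq_sqrt hx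
  have es := Real.sq_sqrt hq.le
  have ey := Real.sq_sqrt (hq.le.trans hqy)
  generalize √x = r at *
  generalize √q = s at *
  generalize √y = t at *
  subst ex es ey
  rw [div_le_iff₀ hq]
  obtain ⟨u, rfl⟩ : ∃ u, r = s - u := ⟨s - r, by ring⟩
  obtain ⟨v, rfl⟩ : ∃ v, t = s + v := ⟨t - s, by ring⟩
  have hu : 0 ≤ u := by linarith
  have hv : 0 ≤ v := by linarith
  have hus : 0 ≤ s - u := hx0
  have k1 : 0 ≤ v ^ 2 * s * (s - u) := by positivity
  have k2 : 0 ≤ u ^ 2 * v * s := by positivity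
  have k3 : 0 ≤ u ^ 2 * v ^ 2 := by positivity
  have k4 : 0 ≤ u ^ 2 * s ^ 2 := by positivity
  nlinarith

/-- A monotone reparametrisation of `[0,1]` in which splitting costs are quadratic. -/
noncomputable def splitCoord (t : ℝ) : ℝ := √t - √(1 - t)

lemma splitCoord_mono : Monotone splitCoord := fun _ _ h =>
  sub_le_sub (Real.sqrt_le_sqrt h) (Real.sqrt_le_sqrt (by linarith))

lemma abs_splitCoord_le {t : ℝ} (h0 : 0 ≤ t) (h1 : t ≤ 1) : |splitCoord t| ≤ 1 := by
  have ha : √t ≤ 1 := Real.sqrt_le_one.2 h1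
  have hb : √(1 - t) ≤ 1 := Real.sqrt_le_one.2 (by linarith)
  rw [splitCoord, abs_le]
  constructor <;> linarith [Real.sqrt_nonneg t, Real.sqrt_nonneg (1 - t)]

lemma exists_split_le {x q y : ℝ} (hx : 0 ≤ x) (hxq : x ≤ q) (hqy : q ≤ y) (hy : y ≤ 1) :
    ∃ α : ℝ, 0 ≤ α ∧ α ≤ 1 ∧ α * x + (1 - α) * y = q ∧
      h2 q - α * h2 x - (1 - α) * h2 y ≤ 2 * (splitCoord y - splitCoord x) ^ 2 := by
  rcases hxq.eq_or_lt with rfl | hxq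
  · exact ⟨1, zero_le_one, le_rfl, by ring, by linarith [sq_nonneg (splitCoord y - splitCoord x)]⟩
  rcases hqy.eq_or_lt with rfl | hqy
  · exact ⟨0, le_rfl, zero_le_one, by ring, by linarith [sq_nonneg (splitCoord q - splitCoord x)]⟩
  have hd : 0 < y - x := by linarith
  have h0 : 0 ≤ (y - q) / (y - x) := div_nonneg (by linarith) hd.le
  have h1 : (y - q) / (y - x) ≤ 1 := (div_le_one hd).2 (by linarith)
  have hα : (y - q) / (y - x) * x + (1 - (y - q) / (y - x)) * y = q := by
    field_simp
    ring
  refine ⟨(y - q) / (y - x), h0, h1, hα, ?_⟩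
  generalize (y - q) / (y - x) = α at *
  have g1 := negMulLog_jensen_gap_le hx (by linarith) (by linarith) h0 h1 hα
  have g2 := negMulLog_jensen_gap_le (x := 1 - x) (q := 1 - q) (y := 1 - y) (by linarith)
    (by linarith) (by linarith) h0 h1 (by linear_combination -hα)
  have b1 := sub_mul_sub_div_le_sqrt hx hxq.le hqy.le (by linarith)
  have b2 := sub_mul_sub_div_le_sqrt (x := 1 - y) (q := 1 - q) (y := 1 - x) (by linarith)
    (by linarith) (by linarith) (by linarith)
  have e2 : (1 - q - (1 - x)) * (1 - y - (1 - q)) / (1 - q)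
      = (1 - q - (1 - y)) * (1 - x - (1 - q)) / (1 - q) := by ring
  have hu : 0 ≤ √y - √x := sub_nonneg.2 (Real.sqrt_le_sqrt (by linarith))
  have hv : 0 ≤ √(1 - x) - √(1 - y) := sub_nonneg.2 (Real.sqrt_le_sqrt (by linarith))
  have hexp : (splitCoord y - splitCoord x) ^ 2 = (√y - √x) ^ 2 + (√(1 - x) - √(1 - y)) ^ 2
      + 2 * ((√y - √x) * (√(1 - x) - √(1 - y))) := by
    rw [splitCoord, splitCoord]
    ring
  have huv := mul_nonneg hu hv
  simp only [h2]
  linarith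

/-- AM-GM in three variables, two of which coincide. -/
lemma three_mul_lt_add_two_mul {a b c : ℝ} (ha : 0 ≤ a) (hb : 0 ≤ b)
    (h : c ^ 3 < a * b ^ 2) : 3 * c < a + 2 * b := by
  by_contra! hle
  have hc : ((a + 2 * b) / 3) ^ 3 ≤ c ^ 3 := by
    gcongr
    linarith
  nlinarith [mul_nonneg ha (sq_nonneg (a - b)), mul_nonneg hb (sq_nonneg (a - b))]

/-- If `∑ w ≤ 1` and `∑ t ≤ 4`, some term `w * t²` is at most `16 / m³`. -/
lemma exists_mul_sq_le {m : ℕ} (hm : 0 < m) {w t : ℕ → ℝ} (hw : ∀ k < m, 0 ≤ w k)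
    (ht : ∀ k < m, 0 ≤ t k) (hws : ∑ k ∈ range m, w k ≤ 1) (hts : ∑ k ∈ range m, t k ≤ 4) :
    ∃ k < m, w k * t k ^ 2 ≤ 16 / (m : ℝ) ^ 3 := by
  by_contra! hlt
  have hm' : (0 : ℝ) < m := Nat.cast_pos.2 hm
  have key : ∀ k ∈ range m, 3 * (1 / (m : ℝ)) < w k + 2 * (t k / 4) := fun k hk => by
    have hk := mem_range.1 hk
    refine three_mul_lt_add_two_mul (hw k hk) (by linarith [ht k hk]) ?_
    have e : (1 / (m : ℝ)) ^ 3 = 16 / (m : ℝ) ^ 3 / 16 := by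
      field_simp
    rw [e]
    linarith [hlt k hk]
  have hsum := sum_lt_sum_of_nonempty (nonempty_range_iff.2 hm.ne') key
  rw [sum_const, card_range, nsmul_eq_mul, sum_add_distrib, ← mul_sum, ← sum_div] at hsum
  have e : (m : ℝ) * (3 * (1 / m)) = 3 := by field_simp
  linarith

/-- One split step is cheap: with `Y` on `{1,…,n}` (`n ≥ 3`), law `w`, and sorted
posteriors `p₁ ≤ ⋯ ≤ p_n` in `[0,1]`, there are `i ∈ {2,…,n−1}` and `α ∈ [0,1]` with
`α·p_{i−1} + (1−α)·p_{i+1} = p_i` whose splitting cost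
`w_i·[h₂(p_i) − α·h₂(p_{i−1}) − (1−α)·h₂(p_{i+1})]` (i.e. `I(X;Z) − I(X;Y)`) is at most
`256/n³`. -/
theorem one_step_split (n : ℕ) (hn : 3 ≤ n) (w p : ℕ → ℝ)
    (hw0 : ∀ y ∈ Finset.Icc 1 n, 0 ≤ w y) (hw1 : ∑ y ∈ Finset.Icc 1 n, w y = 1)
    (hp : ∀ y ∈ Finset.Icc 1 n, 0 ≤ p y ∧ p y ≤ 1)
    (hmono : ∀ y, 1 ≤ y → y < n → p y ≤ p (y + 1)) :
    ∃ i, 2 ≤ i ∧ i ≤ n - 1 ∧ ∃ α : ℝ, 0 ≤ α ∧ α ≤ 1 ∧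
      α * p (i - 1) + (1 - α) * p (i + 1) = p i ∧
      w i * (h2 (p i) - α * h2 (p (i - 1)) - (1 - α) * h2 (p (i + 1)))
        ≤ 256 / (n : ℝ) ^ 3 := by
  obtain ⟨m, rfl⟩ : ∃ m, n = m + 2 := ⟨n - 2, by omega⟩
  have hm : 0 < m := by omega
  have hsub : ∑ k ∈ range m, w (k + 2) ≤ 1 := by
    rw [← hw1, ← sum_image (s := range m) (g := fun k => k + 2) (f := w)
      (fun a _ b _ h => by simpa using h)]
    refine sum_le_sum_of_subset_of_nonneg (fun y hy => ?_) (fun y hy _ => hw0 y hy)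
    obtain ⟨k, hk, rfl⟩ := mem_image.1 hy
    have := mem_range.1 hk
    exact mem_Icc.2 ⟨by omega, by omega⟩
  have hsplit : ∀ k < m, ∃ α : ℝ, 0 ≤ α ∧ α ≤ 1 ∧
      α * p (k + 1) + (1 - α) * p (k + 3) = p (k + 2) ∧
      h2 (p (k + 2)) - α * h2 (p (k + 1)) - (1 - α) * h2 (p (k + 3))
        ≤ 2 * (splitCoord (p (k + 3)) - splitCoord (p (k + 1))) ^ 2 := fun k hk =>
    exists_split_le (hp _ (mem_Icc.2 ⟨by omega, by omega⟩)).1 (hmono _ (by omega) (by omega))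
      (hmono _ (by omega) (by omega)) (hp _ (mem_Icc.2 ⟨by omega, by omega⟩)).2
  have hcoord : ∀ y, 1 ≤ y → y ≤ m + 2 → -1 ≤ splitCoord (p y) ∧ splitCoord (p y) ≤ 1 :=
    fun y hy1 hy2 =>
      have h := hp y (mem_Icc.2 ⟨hy1, hy2⟩)
      abs_le.1 (abs_splitCoord_le h.1 h.2)
  have hw : ∀ k < m, 0 ≤ w (k + 2) := fun k hk => hw0 _ (mem_Icc.2 ⟨by omega, by omega⟩)
  have ht : ∀ k < m, 0 ≤ splitCoord (p (k + 3)) - splitCoord (p (k + 1)) := fun k hk =>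
    sub_nonneg.2 <| splitCoord_mono <|
      (hmono (k + 1) (by omega) (by omega)).trans (hmono (k + 2) (by omega) (by omega))
  have hts : ∑ k ∈ range m, (splitCoord (p (k + 3)) - splitCoord (p (k + 1))) ≤ 4 := by
    have e1 := sum_range_sub (fun k => splitCoord (p (k + 1))) m
    have e2 := sum_range_sub (fun k => splitCoord (p (k + 2))) m
    have e : ∑ k ∈ range m, (splitCoord (p (k + 3)) - splitCoord (p (k + 1)))
        = ∑ k ∈ range m, (splitCoord (p (k + 1 + 1)) - splitCoord (p (k + 1)))
          + ∑ k ∈ range m, (splitCoord (p (k + 1 + 2)) - splitCoord (p (k + 2))) := by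
      rw [← sum_add_distrib]
      exact sum_congr rfl fun k _ => by ring_nf
    rw [e, e1, e2]
    linarith [(hcoord (m + 1) (by omega) (by omega)).2, (hcoord (m + 2) (by omega) le_rfl).2,
      (hcoord (0 + 1) (by omega) (by omega)).1, (hcoord (0 + 2) (by omega) (by omega)).1]
  obtain ⟨k, hk, hle⟩ : ∃ k < m, w (k + 2) *
      (2 * (splitCoord (p (k + 3)) - splitCoord (p (k + 1))) ^ 2)
        ≤ 256 / ((m + 2 : ℕ) : ℝ) ^ 3 := by
    rcases (show 1 ≤ m from hm).eq_or_lt with rfl | hm2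
    · refine ⟨0, hm, ?_⟩
      have hw2 : w (0 + 2) ≤ 1 := by simpa using hsub
      have ht2 : splitCoord (p (0 + 3)) - splitCoord (p (0 + 1)) ≤ 2 := by
        linarith [(hcoord (0 + 3) (by omega) (by omega)).2,
          (hcoord (0 + 1) (by omega) (by omega)).1]
      have hsq := pow_le_pow_left₀ (ht 0 hm) ht2 2
      calc _ ≤ (1 : ℝ) * (2 * 2 ^ 2) :=
            mul_le_mul hw2 (by linarith) (by positivity) zero_le_one
        _ ≤ _ := by norm_num
    · obtain ⟨k, hk, hle⟩ := exists_mul_sq_le hm hw ht hsub hts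
      refine ⟨k, hk, ?_⟩
      have hm2' : (2 : ℝ) ≤ m := by exact_mod_cast hm2
      calc _ = 2 * (w (k + 2) * (splitCoord (p (k + 3)) - splitCoord (p (k + 1))) ^ 2) := by ring
        _ ≤ 2 * (16 / (m : ℝ) ^ 3) := by gcongr
        _ = 256 / (2 * (m : ℝ)) ^ 3 := by
          field_simp
          norm_num
        _ ≤ _ := by
          push_cast
          gcongr
          linarith
  obtain ⟨α, h0, h1, hα, hcost⟩ := hsplit k hk
  exact ⟨k + 2, by omega, by omega, α, h0, h1, hα,
    (mul_le_mul_of_nonneg_left hcost (hw k hk)).trans hle⟩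
end

section
/- Let 𝒴 be a finite set, w : 𝒴 → ℝ a probability vector (w_y ≥ 0, Σ_y w_y = 1), p : 𝒴 → [0,1], and let L ≥ 1 be an integer. Then there exists a function f : 𝒴 → {1,…,L} such that, with W(t) = Σ_{y : f(y)=t} w(y) and q(t) = (Σ_{y : f(y)=t} w(y)·p(y))/W(t) (taken to be 0 when W(t) = 0), Σ_{t=1}^{L} W(t)·h₂(q(t)) − Σ_{y∈𝒴} w(y)·h₂(p(y)) ≤ 64/L². Equivalently, I(X;Y) − I(X;f(Y)) ≤ 64/L². -/
open Finset

theorem negMulLog_le_sub_mul_log {q c : ℝ} (hq : 0 ≤ q) (hc : 0 < c) :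
    Real.negMulLog q ≤ c - q - q * Real.log c := by
  rcases hq.eq_or_lt with rfl | hq
  · simpa using hc.le
  · have h := Real.log_le_sub_one_of_pos (div_pos hc hq)
    rw [Real.log_div hc.ne' hq.ne'] at h
    have h' := mul_le_mul_of_nonneg_left h hq.le
    have e : q * (c / q - 1) = c - q := by field_simp
    rw [e] at h'
    unfold Real.negMulLog
    linarith

theorem neg_mul_log_le_negMulLog_add {p c : ℝ} (hp : 0 ≤ p) (hc : 0 < c) :
    -(p * Real.log c) ≤ Real.negMulLog p + p * (p / c - 1) := by
  rcases hp.eq_or_lt with rfl | hp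
  · simp
  · have h := Real.log_le_sub_one_of_pos (div_pos hp hc)
    rw [Real.log_div hp.ne' hc.ne'] at h
    have h' := mul_le_mul_of_nonneg_left h hp.le
    unfold Real.negMulLog
    linarith

/-- Gibbs' inequality: the binary entropy is at most the cross-entropy. -/
theorem h2_le_crossEntropy {q c : ℝ} (hq0 : 0 ≤ q) (hq1 : q ≤ 1) (hc0 : 0 < c) (hc1 : c < 1) :
    h2 q ≤ -(q * Real.log c) - (1 - q) * Real.log (1 - c) := by
  have h := negMulLog_le_sub_mul_log hq0 hc0
  have h' := negMulLog_le_sub_mul_log (sub_nonneg.2 hq1) (sub_pos.2 hc1)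
  unfold h2
  linarith

/-- The binary relative entropy is at most the chi-square divergence. -/
theorem crossEntropy_le_h2_add {p c : ℝ} (hp0 : 0 ≤ p) (hp1 : p ≤ 1) (hc0 : 0 < c) (hc1 : c < 1) :
    -(p * Real.log c) - (1 - p) * Real.log (1 - c) ≤ h2 p + (p - c) ^ 2 / (c * (1 - c)) := by
  have h := neg_mul_log_le_negMulLog_add hp0 hc0
  have h' := neg_mul_log_le_negMulLog_add (sub_nonneg.2 hp1) (sub_pos.2 hc1)
  have hc : 1 - c ≠ 0 := (sub_pos.2 hc1).ne'
  have e : p * (p / c - 1) + (1 - p) * ((1 - p) / (1 - c) - 1) = (p - c) ^ 2 / (c * (1 - c)) := by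
    field_simp
    ring
  unfold h2
  linarith

/-- Merging a cell increases the conditional entropy by at most the mass of the cell times the
largest chi-square divergence to a common reference point `c`. -/
theorem sum_mul_h2_div_le {Y : Type*} (s : Finset Y) (w p : Y → ℝ) {c ε : ℝ}
    (hw : ∀ y, 0 ≤ w y) (hp : ∀ y, 0 ≤ p y ∧ p y ≤ 1) (hc0 : 0 < c) (hc1 : c < 1)
    (hε : ∀ y ∈ s, (p y - c) ^ 2 / (c * (1 - c)) ≤ ε) :
    (∑ y ∈ s, w y) * h2 ((∑ y ∈ s, w y * p y) / ∑ y ∈ s, w y) ≤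
      ∑ y ∈ s, w y * (h2 (p y) + ε) := by
  have hcross : ∑ y ∈ s, w y * (-(p y * Real.log c) - (1 - p y) * Real.log (1 - c)) ≤
      ∑ y ∈ s, w y * (h2 (p y) + ε) := by
    refine sum_le_sum fun y hy => mul_le_mul_of_nonneg_left ?_ (hw y)
    linarith [crossEntropy_le_h2_add (hp y).1 (hp y).2 hc0 hc1, hε y hy]
  refine le_trans ?_ hcross
  have hsum : ∑ y ∈ s, w y * (-(p y * Real.log c) - (1 - p y) * Real.log (1 - c)) =
      -((∑ y ∈ s, w y * p y) * Real.log c)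
        - ((∑ y ∈ s, w y) - ∑ y ∈ s, w y * p y) * Real.log (1 - c) := by
    rw [← sum_sub_distrib, sum_mul, sum_mul, ← sum_neg_distrib, ← sum_sub_distrib]
    exact sum_congr rfl fun y _ => by ring
  rw [hsum]
  have hA0 : 0 ≤ ∑ y ∈ s, w y * p y := sum_nonneg fun y _ => mul_nonneg (hw y) (hp y).1
  have hAW : ∑ y ∈ s, w y * p y ≤ ∑ y ∈ s, w y :=
    sum_le_sum fun y _ => mul_le_of_le_one_right (hw y) (hp y).2
  generalize ∑ y ∈ s, w y * p y = A at *
  generalize ∑ y ∈ s, w y = W at *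
  rcases (hA0.trans hAW).eq_or_lt with rfl | hW
  · simp [le_antisymm hAW hA0]
  · have h := mul_le_mul_of_nonneg_left
      (h2_le_crossEntropy (div_nonneg hA0 hW.le) ((div_le_one hW).2 hAW) hc0 hc1) hW.le
    refine h.trans_eq ?_
    field_simp

theorem sin_sq_sub_sin_sq (x y : ℝ) :
    Real.sin x ^ 2 - Real.sin y ^ 2 = Real.sin (x - y) * Real.sin (x + y) := by
  rw [Real.sin_sub, Real.sin_add]
  linear_combination Real.sin x ^ 2 * Real.sin_sq_add_cos_sq y * (-1)
    + Real.sin y ^ 2 * Real.sin_sq_add_cos_sq x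

/-- In the angular parametrization `p = sin² θ` the chi-square divergence is at most
`16 (θ - φ)²` whenever `θ` is no further from `φ` than the endpoints of `[0, π / 2]` are. -/
theorem sin_sq_chiSquare_le {θ φ : ℝ} (h0 : 0 < φ) (h1 : φ < Real.pi / 2)
    (hd0 : |θ - φ| ≤ φ) (hd1 : |θ - φ| ≤ Real.pi / 2 - φ) :
    (Real.sin θ ^ 2 - Real.sin φ ^ 2) ^ 2 / (Real.sin φ ^ 2 * (1 - Real.sin φ ^ 2)) ≤
      16 * (θ - φ) ^ 2 := by
  obtain ⟨ha, hb⟩ := abs_le.1 hd0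
  obtain ⟨hc, hd⟩ := abs_le.1 hd1
  have hs : 0 < Real.sin φ := Real.sin_pos_of_pos_of_lt_pi h0 (by linarith)
  have hcos : 0 < Real.cos φ := Real.cos_pos_of_mem_Ioo ⟨by linarith, h1⟩
  have hle : Real.sin (θ - φ) ^ 2 ≤ Real.sin (2 * φ) ^ 2 := by
    rw [← sub_nonneg, sin_sq_sub_sin_sq]
    exact mul_nonneg (Real.sin_nonneg_of_nonneg_of_le_pi (by linarith) (by linarith))
      (Real.sin_nonneg_of_nonneg_of_le_pi (by linarith) (by linarith))
  have hadd : Real.sin (θ + φ) ^ 2 ≤ 4 * Real.sin (2 * φ) ^ 2 := by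
    have e : θ + φ = 2 * φ + (θ - φ) := by ring
    have hu : (Real.sin (2 * φ) * Real.cos (θ - φ)) ^ 2 ≤ Real.sin (2 * φ) ^ 2 := by
      rw [mul_pow]
      exact mul_le_of_le_one_right (sq_nonneg _) (Real.cos_sq_le_one _)
    have hv : (Real.cos (2 * φ) * Real.sin (θ - φ)) ^ 2 ≤ Real.sin (θ - φ) ^ 2 := by
      rw [mul_pow]
      exact mul_le_of_le_one_left (sq_nonneg _) (Real.cos_sq_le_one _)
    rw [e, Real.sin_add]
    linarith [add_sq_le (a := Real.sin (2 * φ) * Real.cos (θ - φ))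
      (b := Real.cos (2 * φ) * Real.sin (θ - φ))]
  have hsin : Real.sin (θ - φ) ^ 2 ≤ (θ - φ) ^ 2 := sq_le_sq.2 Real.abs_sin_le_abs
  have hden : Real.sin φ ^ 2 * (1 - Real.sin φ ^ 2) = Real.sin (2 * φ) ^ 2 / 4 := by
    rw [← Real.cos_sq', Real.sin_two_mul]
    ring
  have hpos : 0 < Real.sin φ ^ 2 * (1 - Real.sin φ ^ 2) := by
    rw [← Real.cos_sq']
    positivity
  rw [div_le_iff₀ hpos, hden, sin_sq_sub_sin_sq, mul_pow]
  calc _ ≤ (θ - φ) ^ 2 * (4 * Real.sin (2 * φ) ^ 2) := by gcongr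
    _ = _ := by ring

/-- The midpoint of the `k`-th of `L` equal subintervals of `[0, π / 2]`. -/
noncomputable def cellAngle (L k : ℕ) : ℝ := (2 * k + 1) * (Real.pi / (4 * L))

theorem cellAngle_bounds {L k : ℕ} (hk : k < L) :
    Real.pi / (4 * L) ≤ cellAngle L k ∧ Real.pi / (4 * L) ≤ Real.pi / 2 - cellAngle L k := by
  have hL : (0 : ℝ) < L := by exact_mod_cast (Nat.zero_le k).trans_lt hk
  have hk' : (k : ℝ) + 1 ≤ L := by exact_mod_cast hk
  have hu : 0 < Real.pi / (4 * L) := by positivity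
  have e : Real.pi / 2 = 2 * L * (Real.pi / (4 * L)) := by field_simp; norm_num
  rw [e, cellAngle]
  constructor <;> nlinarith [mul_nonneg (Nat.cast_nonneg (α := ℝ) k) hu.le]

theorem exists_cellAngle_near {L : ℕ} (hL : 1 ≤ L) {θ : ℝ} (h0 : 0 ≤ θ) (h1 : θ ≤ Real.pi / 2) :
    ∃ k : Fin L, |θ - cellAngle L k| ≤ Real.pi / (4 * L) := by
  have hL' : (0 : ℝ) < L := by exact_mod_cast hL
  set u := Real.pi / (4 * L) with hu_def
  have hu : 0 < u := by positivity
  have e : Real.pi / 2 = 2 * L * u := by rw [hu_def]; field_simp; norm_num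
  rw [e] at h1
  rcases h1.eq_or_lt with h | h
  · refine ⟨⟨L - 1, by omega⟩, ?_⟩
    rw [cellAngle, ← hu_def, h, Nat.cast_sub hL]
    push_cast
    rw [show 2 * L * u - (2 * ((L : ℝ) - 1) + 1) * u = u by ring, abs_of_pos hu]
  · have hx : 0 ≤ θ / (2 * u) := by positivity
    refine ⟨⟨⌊θ / (2 * u)⌋₊, (Nat.floor_lt hx).2 ?_⟩, ?_⟩
    · rw [div_lt_iff₀ (by positivity)]
      linarith
    · have ha := Nat.floor_le hx
      have hb := Nat.lt_floor_add_one (θ / (2 * u))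
      rw [le_div_iff₀ (by positivity)] at ha
      rw [div_lt_iff₀ (by positivity)] at hb
      rw [cellAngle, ← hu_def, abs_le]
      constructor <;> linarith

/-- There are `L` reference points in `(0, 1)` such that every point of `[0, 1]` has chi-square
divergence at most `64 / L ^ 2` to one of them. -/
theorem exists_chiSquare_net {L : ℕ} (hL : 1 ≤ L) :
    ∃ c : Fin L → ℝ, (∀ k, 0 < c k ∧ c k < 1) ∧
      ∀ p : ℝ, 0 ≤ p → p ≤ 1 → ∃ k, (p - c k) ^ 2 / (c k * (1 - c k)) ≤ 64 / (L : ℝ) ^ 2 := by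
  have hL' : (0 : ℝ) < L := by exact_mod_cast hL
  have hu : 0 < Real.pi / (4 * L) := by positivity
  refine ⟨fun k => Real.sin (cellAngle L k) ^ 2, fun k => ?_, fun p hp0 hp1 => ?_⟩
  · obtain ⟨ha, hb⟩ := cellAngle_bounds k.2
    have hs : 0 < Real.sin (cellAngle L k) :=
      Real.sin_pos_of_pos_of_lt_pi (by linarith) (by linarith [Real.pi_pos])
    have hcos : 0 < Real.cos (cellAngle L k) :=
      Real.cos_pos_of_mem_Ioo ⟨by linarith [Real.pi_pos], by linarith⟩
    refine ⟨by positivity, ?_⟩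
    rw [← sub_pos, ← Real.cos_sq']
    positivity
  · obtain ⟨k, hk⟩ := exists_cellAngle_near hL (Real.arcsin_nonneg.2 (Real.sqrt_nonneg p))
      (Real.arcsin_le_pi_div_two _)
    obtain ⟨ha, hb⟩ := cellAngle_bounds k.2
    have h := sin_sq_chiSquare_le (hu.trans_le ha) (by linarith) (hk.trans ha) (hk.trans hb)
    rw [Real.sin_arcsin (by linarith [Real.sqrt_nonneg p]) (Real.sqrt_le_one.2 hp1),
      Real.sq_sqrt hp0] at h
    refine ⟨k, h.trans ?_⟩
    have hsq := sq_le_sq.2 (hk.trans_eq (abs_of_pos hu).symm)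
    calc _ ≤ 16 * (Real.pi / (4 * L)) ^ 2 := by gcongr
      _ = Real.pi ^ 2 / (L : ℝ) ^ 2 := by field_simp; norm_num
      _ ≤ _ := by
        gcongr
        nlinarith [Real.pi_pos, Real.pi_le_four]

/-- Greedy-merge degrading for binary input: for a joint distribution of a binary `X`
and finite `Y` (law `w`, posteriors `p`) and any `L ≥ 1`, there is a quantizer
`f : 𝒴 → {1,…,L}` with `I(X;Y) − I(X;f(Y)) = H(X|f(Y)) − H(X|Y) ≤ 64/L²`, where the
merged law is `W(t) = Σ_{f(y)=t} w(y)` and the merged posterior is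
`q(t) = (Σ_{f(y)=t} w(y)·p(y))/W(t)` (equal to `0` when `W(t) = 0`, by the Lean
convention that division by zero is zero). -/
theorem binary_greedy_merge {Y : Type*} [Fintype Y] (w p : Y → ℝ)
    (hw0 : ∀ y, 0 ≤ w y) (hw1 : ∑ y, w y = 1)
    (hp : ∀ y, 0 ≤ p y ∧ p y ≤ 1)
    (L : ℕ) (hL : 1 ≤ L) :
    ∃ f : Y → Fin L,
      (∑ t : Fin L,
          (∑ y ∈ Finset.univ.filter (fun y => f y = t), w y) *
            h2 ((∑ y ∈ Finset.univ.filter (fun y => f y = t), w y * p y) /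
              (∑ y ∈ Finset.univ.filter (fun y => f y = t), w y)))
        - (∑ y, w y * h2 (p y)) ≤ 64 / (L : ℝ) ^ 2 := by
  classical
  obtain ⟨c, hc, hnet⟩ := exists_chiSquare_net hL
  choose f hf using fun y => hnet (p y) (hp y).1 (hp y).2
  refine ⟨f, ?_⟩
  have hcell : ∀ t : Fin L, _ := fun t =>
    sum_mul_h2_div_le (univ.filter fun y => f y = t) w p (ε := 64 / (L : ℝ) ^ 2)
      hw0 hp (hc t).1 (hc t).2 fun y hy => (mem_filter.1 hy).2 ▸ hf y
  have htotal := sum_le_sum fun t (_ : t ∈ (univ : Finset (Fin L))) => hcell t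
  rw [sum_fiberwise] at htotal
  simp only [mul_add, sum_add_distrib, ← sum_mul, hw1, one_mul] at htotal
  linarith
end

section
/- Let 𝒳 be a finite set with |𝒳| = q ≥ 2, let 𝒴 be a finite set, and let P : 𝒳 × 𝒴 → ℝ be a joint probability mass function with marginal P_Y(y) = Σ_x P(x,y) and conditionals v_y(x) = P(x,y)/P_Y(y) (taken to be 0 when P_Y(y) = 0). For any integer L ≥ 1, set Λ = ⌊L^{1/(q−1)}⌋. Then there exists a function f : 𝒴 → {1,…,Λ^{q−1}} (so f takes at most L values) such that Σ_t W(t)·H(V_t) − Σ_y P_Y(y)·H(v_y) ≤ 64·(q−1)·Λ⁻², where W(t) = Σ_{y : f(y)=t} P_Y(y) and V_t(x) = (Σ_{y : f(y)=t} P(x,y))/W(t) (taken to be 0 when W(t) = 0). Equivalently, I(X;Y) − I(X;f(Y)) ≤ 64·(q−1)·⌊L^{1/(q−1)}⌋⁻². -/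
open Finset

/-- The entropy deficit of splitting a mass `a + b` into `a` and `b`: the unnormalized
binary entropy. -/
noncomputable def binEnt (a b : ℝ) : ℝ :=
  Real.negMulLog a + Real.negMulLog b - Real.negMulLog (a + b)

/-- Unnormalized entropy of a nonnegative vector, homogeneous of degree one. -/
noncomputable def massEnt {X : Type*} [Fintype X] (v : X → ℝ) : ℝ :=
  ∑ x, Real.negMulLog (v x) - Real.negMulLog (∑ x, v x)

theorem mul_Hent_div_sum {X : Type*} [Fintype X] (v : X → ℝ) (hv : ∀ x, 0 ≤ v x) :
    (∑ x, v x) * Hent (fun x => v x / ∑ x', v x') = massEnt v := by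
  rcases (Finset.sum_nonneg fun x _ => hv x : 0 ≤ ∑ x, v x).eq_or_lt with h | h
  · have h0 := (Finset.sum_eq_zero_iff_of_nonneg fun x _ => hv x).1 h.symm
    simp only [Finset.mem_univ, true_imp_iff] at h0
    simp [massEnt, h0]
  · have key : ∀ x, (∑ x', v x') * Real.negMulLog (v x / ∑ x', v x')
        = Real.negMulLog (v x) + v x * Real.log (∑ x', v x') := by
      intro x
      rcases (hv x).eq_or_lt with hx | hx
      · simp [← hx]
      · rw [Real.negMulLog, Real.log_div hx.ne' h.ne', Real.negMulLog]
        field_simp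
        ring
    rw [Hent, Finset.mul_sum, Finset.sum_congr rfl fun x _ => key x, Finset.sum_add_distrib,
      ← Finset.sum_mul, massEnt, Real.negMulLog.eq_def (∑ x, v x)]
    ring

theorem massEnt_comp_equiv {X X' : Type*} [Fintype X] [Fintype X'] (e : X' ≃ X) (v : X → ℝ) :
    massEnt (fun i => v (e i)) = massEnt v := by
  rw [massEnt, massEnt, e.sum_comp v, e.sum_comp fun x => Real.negMulLog (v x)]

/-- Chain rule for the unnormalized entropy. -/
theorem massEnt_succ {n : ℕ} (v : Fin (n + 2) → ℝ) :
    massEnt v = binEnt (v 0) (∑ i : Fin (n + 1), v i.succ)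
      + massEnt (fun i : Fin (n + 1) => v i.succ) := by
  rw [massEnt, massEnt, binEnt, Fin.sum_univ_succ v,
    Fin.sum_univ_succ fun i => Real.negMulLog (v i)]
  ring

theorem neg_negMulLog_sub_le {a t A T : ℝ} (ha : 0 ≤ a) (hat : a ≤ t) (hA : 0 < A)
    (hT : 0 < T) :
    a * Real.log a - a * Real.log t ≤
      a * (Real.log A - Real.log T) + (T / A * (a ^ 2 / t) - a) := by
  rcases ha.eq_or_lt with h | h
  · simp [← h]
  · have ht : 0 < t := h.trans_le hat
    have h1 := Real.log_le_sub_one_of_pos (show 0 < a * T / (t * A) by positivity)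
    rw [Real.log_div (by positivity) (by positivity), Real.log_mul h.ne' hT.ne',
      Real.log_mul ht.ne' hA.ne'] at h1
    have h2 := mul_le_mul_of_nonneg_left h1 ha
    have h3 : a * (a * T / (t * A) - 1) = T / A * (a ^ 2 / t) - a := by
      field_simp
    linarith

/-- Merging masses whose split proportions lie in the interval `[m, M]` costs at most `c` per
unit of mass. -/
theorem binEnt_merge_le {Y : Type*} (s : Finset Y) (a b : Y → ℝ) (ha : ∀ y, 0 ≤ a y)
    (hb : ∀ y, 0 ≤ b y) {m M c : ℝ} (hm : ∀ y ∈ s, m * (a y + b y) ≤ a y)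
    (hM : ∀ y ∈ s, a y ≤ M * (a y + b y))
    (hc : ∀ β γ : ℝ, 0 ≤ β → 0 ≤ γ →
      (M * (β + γ) - β) * (β - m * (β + γ)) ≤ c * (β * γ)) (hc0 : 0 ≤ c) :
    binEnt (∑ y ∈ s, a y) (∑ y ∈ s, b y) - ∑ y ∈ s, binEnt (a y) (b y)
      ≤ c * (∑ y ∈ s, a y + ∑ y ∈ s, b y) := by
  have hA0 : 0 ≤ ∑ y ∈ s, a y := Finset.sum_nonneg fun y _ => ha y
  have hB0 : 0 ≤ ∑ y ∈ s, b y := Finset.sum_nonneg fun y _ => hb y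
  rcases hA0.eq_or_lt with hA | hA
  · have h0 := (Finset.sum_eq_zero_iff_of_nonneg fun y _ => ha y).1 hA.symm
    have h1 : ∑ y ∈ s, binEnt (a y) (b y) = 0 :=
      Finset.sum_eq_zero fun y hy => by simp [binEnt, h0 y hy]
    rw [h1, ← hA]
    simp only [binEnt, Real.negMulLog_zero, zero_add, sub_self]
    positivity
  rcases hB0.eq_or_lt with hB | hB
  · have h0 := (Finset.sum_eq_zero_iff_of_nonneg fun y _ => hb y).1 hB.symm
    have h1 : ∑ y ∈ s, binEnt (a y) (b y) = 0 :=
      Finset.sum_eq_zero fun y hy => by simp [binEnt, h0 y hy]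
    rw [h1, ← hB]
    simp only [binEnt, Real.negMulLog_zero, add_zero, sub_self]
    positivity
  set A := ∑ y ∈ s, a y with hAdef
  set B := ∑ y ∈ s, b y with hBdef
  have hT : 0 < A + B := by positivity
  have hquad : ∀ y ∈ s, a y ^ 2 / (a y + b y) ≤ (M + m) * a y - m * M * (a y + b y) := by
    intro y hy
    rcases (add_nonneg (ha y) (hb y)).eq_or_lt with h | h
    · have : a y = 0 := by linarith [ha y, hb y]
      rw [← h, this]
      simp
    · rw [div_le_iff₀ h]
      nlinarith [mul_nonneg (sub_nonneg.2 (hm y hy)) (sub_nonneg.2 (hM y hy))]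
  have hb2 : ∀ y, b y ^ 2 / (a y + b y) = b y - a y + a y ^ 2 / (a y + b y) := by
    intro y
    rcases (add_nonneg (ha y) (hb y)).eq_or_lt with h | h
    · have h1 : a y = 0 := by linarith [ha y, hb y]
      have h2 : b y = 0 := by linarith [ha y, hb y]
      simp [h1, h2]
    · field_simp
      ring
  set Q := ∑ y ∈ s, a y ^ 2 / (a y + b y) with hQdef
  have hQ : Q ≤ (M + m) * A - m * M * (A + B) := by
    refine (Finset.sum_le_sum hquad).trans_eq ?_
    rw [Finset.sum_sub_distrib, ← Finset.mul_sum, ← Finset.mul_sum, Finset.sum_add_distrib]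
  have hpoint : ∀ y ∈ s, - binEnt (a y) (b y) ≤
      a y * (Real.log A - Real.log (A + B)) + b y * (Real.log B - Real.log (A + B))
      + ((A + B) / A * (a y ^ 2 / (a y + b y))
        + (A + B) / B * (b y - a y + a y ^ 2 / (a y + b y)) - (a y + b y)) := by
    intro y _
    have h1 := neg_negMulLog_sub_le (ha y) (le_add_of_nonneg_right (hb y)) hA hT
    have h2 := neg_negMulLog_sub_le (hb y) (le_add_of_nonneg_left (ha y)) hB hT
    rw [hb2] at h2
    simp only [binEnt, Real.negMulLog]
    linarith
  have hsum := Finset.sum_le_sum hpoint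
  simp only [Finset.sum_add_distrib, Finset.sum_sub_distrib, ← Finset.mul_sum,
    ← Finset.sum_mul, Finset.sum_neg_distrib] at hsum
  simp only [← hAdef, ← hBdef, ← hQdef] at hsum
  have hfin : (A + B) / A * Q + (A + B) / B * (B - A + Q) - (A + B) ≤ c * (A + B) := by
    have h1 : (A + B) / A * Q + (A + B) / B * (B - A + Q) - (A + B)
        = (A + B) * (((A + B) * Q - A ^ 2) / (A * B)) := by
      field_simp
      ring
    have h2 : ((A + B) * Q - A ^ 2) / (A * B) ≤ c := by
      rw [div_le_iff₀ (by positivity)]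
      nlinarith [hc A B hA.le hB.le, mul_le_mul_of_nonneg_left hQ hT.le]
    rw [h1, mul_comm c]
    exact mul_le_mul_of_nonneg_left h2 hT.le
  have hbin : binEnt A B = -(A * (Real.log A - Real.log (A + B))
      + B * (Real.log B - Real.log (A + B))) := by
    simp only [binEnt, Real.negMulLog]
    ring
  linarith

theorem exists_lt_mem_step (g : ℕ → ℝ) (x : ℝ) (h0 : g 0 ≤ x) :
    ∀ n : ℕ, 1 ≤ n → x ≤ g n → ∃ k < n, g k ≤ x ∧ x ≤ g (k + 1) := by
  intro n hn
  induction n, hn using Nat.le_induction with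
  | base => exact fun h => ⟨0, one_pos, h0, h⟩
  | succ n _ ih =>
    intro h
    rcases le_total x (g n) with hx | hx
    · obtain ⟨k, hk, h'⟩ := ih hx
      exact ⟨k, hk.trans n.lt_succ_self, h'⟩
    · exact ⟨n, n.lt_succ_self, hx, h⟩

/-- With proportions written as `sin² θ`, the intervals of proportions have cost the squared
sine of the angular width. -/
theorem sin_sq_interval_bound (u w β γ : ℝ) :
    (Real.sin u ^ 2 * (β + γ) - β) * (β - Real.sin w ^ 2 * (β + γ))
      ≤ Real.sin (u - w) ^ 2 * (β * γ) := by
  have hu : Real.sin u ^ 2 * (β + γ) - β = Real.sin u ^ 2 * γ - Real.cos u ^ 2 * β := by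
    linear_combination β * Real.sin_sq_add_cos_sq u
  have hw : β - Real.sin w ^ 2 * (β + γ) = Real.cos w ^ 2 * β - Real.sin w ^ 2 * γ := by
    linear_combination -β * Real.sin_sq_add_cos_sq w
  rw [hu, hw, Real.sin_sub]
  linarith [sq_nonneg (Real.cos u * Real.cos w * β - Real.sin u * Real.sin w * γ)]

/-- Binary quantizer with `N` levels and loss of order `N⁻²` on every subset of a cell. -/
theorem exists_binary_quantizer {Y : Type*} (N : ℕ) (hN : 1 ≤ N) (a b : Y → ℝ)
    (ha : ∀ y, 0 ≤ a y) (hb : ∀ y, 0 ≤ b y) :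
    ∃ f : Y → Fin N, ∀ s : Finset Y, ∀ k, (∀ y ∈ s, f y = k) →
      binEnt (∑ y ∈ s, a y) (∑ y ∈ s, b y) - ∑ y ∈ s, binEnt (a y) (b y)
        ≤ 64 / (N : ℝ) ^ 2 * (∑ y ∈ s, a y + ∑ y ∈ s, b y) := by
  have hN0 : (0 : ℝ) < N := by exact_mod_cast hN
  set δ : ℝ := Real.pi / 2 / N with hδ
  have hcell : ∀ y, ∃ k : Fin N, Real.sin ((k : ℕ) * δ) ^ 2 * (a y + b y) ≤ a y ∧
      a y ≤ Real.sin (((k : ℕ) + 1 : ℕ) * δ) ^ 2 * (a y + b y) := by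
    intro y
    obtain ⟨k, hk, h⟩ := exists_lt_mem_step
      (fun k => Real.sin (k * δ) ^ 2 * (a y + b y)) (a y) (by simpa using ha y) N hN (by
        have : (N : ℝ) * δ = Real.pi / 2 := by rw [hδ]; field_simp
        simpa [this] using hb y)
    exact ⟨⟨k, hk⟩, h⟩
  choose f hf1 hf2 using hcell
  have hsin : Real.sin δ ^ 2 ≤ 64 / (N : ℝ) ^ 2 := by
    have h1 : Real.sin δ ^ 2 ≤ δ ^ 2 := sq_le_sq.2 Real.abs_sin_le_abs
    have h2 : δ ^ 2 = (Real.pi / 2) ^ 2 / (N : ℝ) ^ 2 := by rw [hδ, div_pow]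
    have h3 : (Real.pi / 2) ^ 2 ≤ 64 := by nlinarith [Real.pi_pos, Real.pi_le_four]
    rw [h2] at h1
    exact h1.trans (by gcongr)
  refine ⟨f, fun s k hs => binEnt_merge_le s a b ha hb
    (m := Real.sin ((k : ℕ) * δ) ^ 2) (M := Real.sin (((k : ℕ) + 1 : ℕ) * δ) ^ 2)
    (fun y hy => hs y hy ▸ hf1 y) (fun y hy => hs y hy ▸ hf2 y) ?_ (by positivity)⟩
  intro β γ hβ hγ
  refine (sin_sq_interval_bound _ _ β γ).trans ?_
  have : (((k : ℕ) + 1 : ℕ) : ℝ) * δ - (k : ℕ) * δ = δ := by push_cast; ring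
  rw [this]
  exact mul_le_mul_of_nonneg_right hsin (mul_nonneg hβ hγ)

/-- Product quantizer: one binary quantizer for each coordinate of the one-hot representation
except the last. -/
theorem exists_product_quantizer {Y : Type*} (N : ℕ) (hN : 1 ≤ N) :
    ∀ (n : ℕ) (P : Fin (n + 1) → Y → ℝ), (∀ i y, 0 ≤ P i y) →
    ∃ f : Y → (Fin n → Fin N), ∀ s : Finset Y, ∀ k, (∀ y ∈ s, f y = k) →
      massEnt (fun i => ∑ y ∈ s, P i y) - ∑ y ∈ s, massEnt (fun i => P i y)
        ≤ 64 * n / (N : ℝ) ^ 2 * ∑ y ∈ s, ∑ i, P i y := by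
  intro n
  induction n with
  | zero =>
    intro P _
    exact ⟨fun _ i => i.elim0, fun s k _ => by simp [massEnt]⟩
  | succ n ih =>
    intro P hP
    obtain ⟨f, hf⟩ := ih (fun i => P i.succ) fun i => hP i.succ
    obtain ⟨g, hg⟩ := exists_binary_quantizer N hN (P 0) (fun y => ∑ i : Fin (n + 1), P i.succ y)
      (hP 0) fun y => Finset.sum_nonneg fun i _ => hP i.succ y
    refine ⟨fun y => Fin.cons (g y) (f y), fun s k hs => ?_⟩
    have h1 := hf s (Fin.tail k) fun y hy => by simp [← hs y hy]
    have h2 := hg s (k 0) fun y hy => by simp [← hs y hy]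
    simp only [massEnt_succ, Finset.sum_add_distrib, Fin.sum_univ_succ (n := n + 1)]
    rw [Finset.sum_comm (s := s)] at h2
    rw [Finset.sum_comm (s := s) (f := fun y (i : Fin (n + 1)) => P i.succ y)] at h1 ⊢
    have h3 : 0 ≤ ∑ y ∈ s, P 0 y := Finset.sum_nonneg fun y _ => hP 0 y
    have h4 : 0 ≤ 64 * (n : ℝ) / (N : ℝ) ^ 2 * ∑ y ∈ s, P 0 y := by positivity
    have h5 : 64 * ((n + 1 : ℕ) : ℝ) / (N : ℝ) ^ 2 = 64 * n / (N : ℝ) ^ 2 + 64 / (N : ℝ) ^ 2 := by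
      push_cast
      ring
    rw [h5]
    linarith

/-- One-hot degrading for general input alphabets: given a joint pmf `P` on `𝒳 × 𝒴` with
`|𝒳| = q ≥ 2` and any `L ≥ 1`, with `Λ = ⌊L^{1/(q−1)}⌋` there is a quantizer
`f : 𝒴 → {1,…,Λ^{q−1}}` (so `f` takes at most `L` values) with
`I(X;Y) − I(X;f(Y)) = H(X|f(Y)) − H(X|Y) ≤ 64·(q−1)·Λ⁻²`. -/
theorem onehot_degrading {X Y : Type*} [Fintype X] [Fintype Y]
    (hq : 2 ≤ Fintype.card X)
    (P : X → Y → ℝ)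
    (hP0 : ∀ x y, 0 ≤ P x y)
    (hP1 : ∑ x : X, ∑ y : Y, P x y = 1)
    (L : ℕ) (hL : 1 ≤ L) :
    ∃ f : Y → Fin ((⌊(L : ℝ) ^ ((1 : ℝ) / ((Fintype.card X : ℝ) - 1))⌋₊) ^
        (Fintype.card X - 1)),
      (∑ t, (∑ y ∈ Finset.univ.filter (fun y => f y = t), ∑ x : X, P x y) *
          Hent (fun x => (∑ y ∈ Finset.univ.filter (fun y => f y = t), P x y) /
            (∑ y ∈ Finset.univ.filter (fun y => f y = t), ∑ x' : X, P x' y)))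
        - (∑ y : Y, (∑ x : X, P x y) * Hent (fun x => P x y / ∑ x' : X, P x' y))
        ≤ 64 * ((Fintype.card X : ℝ) - 1) /
            ((⌊(L : ℝ) ^ ((1 : ℝ) / ((Fintype.card X : ℝ) - 1))⌋₊ : ℝ)) ^ 2 := by
  classical
  obtain ⟨n, hn⟩ : ∃ n, Fintype.card X = n + 1 := ⟨Fintype.card X - 1, by omega⟩
  have hN : 1 ≤ ⌊(L : ℝ) ^ ((1 : ℝ) / ((Fintype.card X : ℝ) - 1))⌋₊ := by
    rw [Nat.one_le_floor_iff]
    refine Real.one_le_rpow (by exact_mod_cast hL) (one_div_nonneg.2 ?_)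
    rw [hn]
    push_cast
    linarith [n.cast_nonneg (α := ℝ)]
  generalize ⌊(L : ℝ) ^ ((1 : ℝ) / ((Fintype.card X : ℝ) - 1))⌋₊ = N at hN ⊢
  have e : Fin (n + 1) ≃ X := (Fintype.equivFinOfCardEq hn).symm
  obtain ⟨f, hf⟩ := exists_product_quantizer N hN n (fun i => P (e i)) fun i => hP0 (e i)
  have hcard : N ^ n = N ^ (Fintype.card X - 1) := by rw [hn, Nat.add_sub_cancel]
  let σ : (Fin n → Fin N) ≃ Fin (N ^ (Fintype.card X - 1)) :=
    finFunctionFinEquiv.trans (finCongr hcard)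
  refine ⟨fun y => σ (f y), ?_⟩
  have hcell : ∀ t, (∑ y ∈ Finset.univ.filter (fun y => σ (f y) = t), ∑ x : X, P x y) *
      Hent (fun x => (∑ y ∈ Finset.univ.filter (fun y => σ (f y) = t), P x y) /
        (∑ y ∈ Finset.univ.filter (fun y => σ (f y) = t), ∑ x' : X, P x' y))
      ≤ ∑ y ∈ Finset.univ.filter (fun y => σ (f y) = t),
        (massEnt (fun x => P x y) + 64 * n / (N : ℝ) ^ 2 * ∑ x, P x y) := by
    intro t
    have h := hf (Finset.univ.filter fun y => σ (f y) = t) (σ.symm t) fun y hy => by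
      rw [← (Finset.mem_filter.1 hy).2, σ.symm_apply_apply]
    have hs : ∀ y, ∑ i, P (e i) y = ∑ x, P x y := fun y => e.sum_comp fun x => P x y
    have hm : ∀ y, massEnt (fun i => P (e i) y) = massEnt fun x => P x y :=
      fun y => massEnt_comp_equiv e fun x => P x y
    simp only [hs, hm] at h
    rw [massEnt_comp_equiv e fun x => ∑ y ∈ Finset.univ.filter (fun y => σ (f y) = t), P x y] at h
    rw [Finset.sum_comm, mul_Hent_div_sum _ fun x => Finset.sum_nonneg fun y _ => hP0 x y,
      Finset.sum_add_distrib, ← Finset.mul_sum]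
    linarith
  have hsum := Finset.sum_le_sum fun t (_ : t ∈ Finset.univ) => hcell t
  rw [Finset.sum_fiberwise, Finset.sum_add_distrib, ← Finset.mul_sum, Finset.sum_comm (s := univ)
    (t := univ) (f := fun y x => P x y), hP1, mul_one] at hsum
  have hY : ∑ y, (∑ x, P x y) * Hent (fun x => P x y / ∑ x', P x' y)
      = ∑ y, massEnt (fun x => P x y) :=
    Finset.sum_congr rfl fun y _ => mul_Hent_div_sum _ fun x => hP0 x y
  have hnR : (Fintype.card X : ℝ) - 1 = n := by rw [hn]; push_cast; ring
  rw [hY, hnR]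
  linarith
end

section
/- For all 0 ≤ p₀ ≤ p₁ ≤ 1 and all α ∈ [0,1]: h₂(α·p₀ + (1−α)·p₁) − α·h₂(p₀) − (1−α)·h₂(p₁) ≤ log(1 + p₁ − p₀). -/
/-- The pointwise form of the Gibbs inequality, against the unnormalized weight `c / Z`. -/
lemma negMulLog_le_cross_entropy {m c Z : ℝ} (hm : 0 ≤ m) (hmc : m ≤ c) (hZ : 0 < Z) :
    Real.negMulLog m ≤ m * (Real.log Z - Real.log c) + (c / Z - m) := by
  rcases hm.eq_or_lt with rfl | hm
  · simpa using div_nonneg hmc hZ.le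
  have hc : 0 < c := hm.trans_le hmc
  have hlog := Real.log_le_sub_one_of_pos (div_pos (div_pos hc hZ) hm)
  rw [Real.log_div (div_pos hc hZ).ne' hm.ne', Real.log_div hc.ne' hZ.ne'] at hlog
  have hmul := mul_le_mul_of_nonneg_left hlog hm.le
  have hcancel : m * (c / Z / m - 1) = c / Z - m := by field_simp
  rw [Real.negMulLog]
  linarith

lemma mul_log_le_mul_log {a b : ℝ} (ha : 0 ≤ a) (hab : a ≤ b) :
    a * Real.log a ≤ a * Real.log b := by
  rcases ha.eq_or_lt with rfl | ha
  · simp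
  · gcongr

/-- Logarithmic bound on the concavity gap of the binary entropy function. -/
theorem h2_gap_le_log (p₀ p₁ α : ℝ)
    (h0 : 0 ≤ p₀) (h01 : p₀ ≤ p₁) (h1 : p₁ ≤ 1)
    (hα0 : 0 ≤ α) (hα1 : α ≤ 1) :
    h2 (α * p₀ + (1 - α) * p₁) - α * h2 p₀ - (1 - α) * h2 p₁
      ≤ Real.log (1 + p₁ - p₀) := by
  set m := α * p₀ + (1 - α) * p₁ with hm
  have hZ : 0 < 1 + p₁ - p₀ := by linarith
  have hm_ge : p₀ ≤ m := by nlinarith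
  have hm_le : m ≤ p₁ := by nlinarith
  -- Compare with the distribution proportional to `(p₁, 1 - p₀)`.
  have hgibbs₁ := negMulLog_le_cross_entropy (h0.trans hm_ge) hm_le hZ
  have hgibbs₀ := negMulLog_le_cross_entropy (m := 1 - m) (c := 1 - p₀)
    (by linarith) (by linarith) hZ
  have hsum : p₁ / (1 + p₁ - p₀) + (1 - p₀) / (1 + p₁ - p₀) = 1 := by
    rw [← add_div, div_eq_one_iff_eq hZ.ne']
    ring
  have hlog₀ := mul_le_mul_of_nonneg_left (mul_log_le_mul_log h0 h01) hα0
  have hlog₁ := mul_le_mul_of_nonneg_left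
    (mul_log_le_mul_log (a := 1 - p₁) (b := 1 - p₀) (by linarith) (by linarith))
    (sub_nonneg.2 hα1)
  have hh2 : h2 m ≤ Real.log (1 + p₁ - p₀) - m * Real.log p₁ - (1 - m) * Real.log (1 - p₀) := by
    rw [h2]
    linarith
  rw [hm] at hh2 ⊢
  simp only [h2, Real.negMulLog] at hh2 ⊢
  linarith
end

section
/- Let 0 ≤ p₀ ≤ p₁ ≤ 1 with p₁ > 0 and p₀ < 1, and set p = p₁/(1 + p₁ − p₀). Then p₀ ≤ p ≤ p₁ and p ∈ (0,1), and the binary Kullback–Leibler divergences satisfy d₂(p₀‖p) ≤ (1 − p₀)·log(1 + p₁ − p₀) and d₂(p₁‖p) ≤ p₁·log(1 + p₁ − p₀). -/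
/-- The binary Kullback–Leibler divergence `d₂(a‖b)` (natural log, with the
conventions inherited from Lean: `0·log 0 = 0`). -/
noncomputable def d2 (a b : ℝ) : ℝ :=
  a * Real.log (a / b) + (1 - a) * Real.log ((1 - a) / (1 - b))

/-- For `0 ≤ p₀ ≤ p₁ ≤ 1` with `p₁ > 0` and `p₀ < 1`, the point
`p = p₁/(1 + p₁ − p₀)` lies in `[p₀, p₁] ∩ (0,1)` and satisfies
`d₂(p₀‖p) ≤ (1−p₀)·log(1+p₁−p₀)` and `d₂(p₁‖p) ≤ p₁·log(1+p₁−p₀)`. -/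
theorem kl_bounds_at_special_point (p₀ p₁ : ℝ)
    (h0 : 0 ≤ p₀) (h01 : p₀ ≤ p₁) (h1 : p₁ ≤ 1)
    (hp1 : 0 < p₁) (hp0 : p₀ < 1) :
    p₀ ≤ p₁ / (1 + p₁ - p₀) ∧ p₁ / (1 + p₁ - p₀) ≤ p₁ ∧
    0 < p₁ / (1 + p₁ - p₀) ∧ p₁ / (1 + p₁ - p₀) < 1 ∧
    d2 p₀ (p₁ / (1 + p₁ - p₀)) ≤ (1 - p₀) * Real.log (1 + p₁ - p₀) ∧
    d2 p₁ (p₁ / (1 + p₁ - p₀)) ≤ p₁ * Real.log (1 + p₁ - p₀) := by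
  have hs : 0 < 1 + p₁ - p₀ := by linarith
  have hlow : p₀ ≤ p₁ / (1 + p₁ - p₀) := by
    rw [le_div_iff₀ hs]
    nlinarith [mul_nonneg (sub_nonneg.2 h01) (sub_nonneg.2 hp0.le)]
  have hupp : p₁ / (1 + p₁ - p₀) ≤ p₁ := div_le_self hp1.le (by linarith)
  have hpos : 0 < p₁ / (1 + p₁ - p₀) := div_pos hp1 hs
  have hlt : p₁ / (1 + p₁ - p₀) < 1 := by
    rw [div_lt_one hs]
    linarith
  refine ⟨hlow, hupp, hpos, hlt, ?_, ?_⟩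
  · have hlog : Real.log (p₀ / (p₁ / (1 + p₁ - p₀))) ≤ 0 :=
      Real.log_nonpos (div_nonneg h0 hpos.le) ((div_le_one hpos).2 hlow)
    have hcompl : 1 - p₁ / (1 + p₁ - p₀) = (1 - p₀) / (1 + p₁ - p₀) := by
      field_simp
      ring
    rw [d2, hcompl, div_div_cancel₀ (sub_pos.2 hp0).ne']
    linarith [mul_nonpos_of_nonneg_of_nonpos h0 hlog]
  · have hlog : Real.log ((1 - p₁) / (1 - p₁ / (1 + p₁ - p₀))) ≤ 0 :=
      Real.log_nonpos (div_nonneg (sub_nonneg.2 h1) (sub_pos.2 hlt).le)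
        ((div_le_one (sub_pos.2 hlt)).2 (by linarith))
    rw [d2, div_div_cancel₀ hp1.ne']
    linarith [mul_nonpos_of_nonneg_of_nonpos (sub_nonneg.2 h1) hlog]
end

section
/- Let m ≥ 1 be an integer and let a : {1,…,m} → ℝ satisfy a(1) ≥ 1 and a(i) ≥ a(i−1) + √(2·a(i−1)) for all 2 ≤ i ≤ m. Then a(m) ≥ (m+1)²/4. -/
/-- Growth of the recursion `a(i) ≥ a(i−1) + √(2·a(i−1))` started from `a(1) ≥ 1`:
after `m` steps, `a(m) ≥ (m+1)²/4`. -/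
theorem recursion_growth (m : ℕ) (hm : 1 ≤ m) (a : ℕ → ℝ)
    (h1 : 1 ≤ a 1)
    (hrec : ∀ i, 2 ≤ i → i ≤ m → a (i - 1) + Real.sqrt (2 * a (i - 1)) ≤ a i) :
    ((m : ℝ) + 1) ^ 2 / 4 ≤ a m := by
  induction m, hm using Nat.le_induction with
  | base => norm_num; exact h1
  | succ k hk ih =>
    have ha := ih fun i hi hik => hrec i hi (by omega)
    have hstep := hrec (k + 1) (by omega) le_rfl
    rw [Nat.add_sub_cancel] at hstep
    have hk' : (1 : ℝ) ≤ k := by exact_mod_cast hk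
    have hsqrt : (2 * (k : ℝ) + 3) / 4 ≤ Real.sqrt (2 * a k) :=
      Real.le_sqrt_of_sq_le (by nlinarith)
    push_cast
    linarith
end

section
/- For all 0 ≤ p ≤ p' ≤ q' ≤ q ≤ 1 and all α ∈ [0,1]: h₂(α·p' + (1−α)·q') − α·h₂(p') − (1−α)·h₂(q') ≤ h₂(α·p + (1−α)·q) − α·h₂(p) − (1−α)·h₂(q). That is, the concavity gap of the binary entropy function at a pair of points is monotone under widening the pair. -/
/-- The concavity gap of a concave function at a pair `(x, y)` does not increase when `x` is moved
towards `y` along the segment. -/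
theorem ConcaveOn.gap_le_gap_of_mem_segment {E : Type*} [AddCommGroup E] [Module ℝ E] {s : Set E}
    {f : E → ℝ} (hf : ConcaveOn ℝ s f) {x y z : E} (hx : x ∈ s) (hy : y ∈ s)
    (hz : z ∈ segment ℝ x y) {a b : ℝ} (ha : 0 ≤ a) (hb : 0 ≤ b) (hab : a + b = 1) :
    f (a • z + b • y) - a * f z - b * f y ≤ f (a • x + b • y) - a * f x - b * f y := by
  have hM : a • z + b • y ∈ s := hf.1 (hf.1.segment_subset hx hy hz) hy ha hb hab
  obtain ⟨c, t, hc, ht, hct, rfl⟩ := hz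
  obtain rfl : b = 1 - a := by linarith
  obtain rfl : c = 1 - t := by linarith
  have hat : 0 ≤ a * t := mul_nonneg ha ht
  rcases (add_nonneg hat hb).eq_or_lt with hD | hD
  · obtain rfl : a = 1 := by linarith
    obtain rfl : t = 0 := by linarith
    simp
  · set M := a • ((1 - t) • x + t • y) + (1 - a) • y with hMdef
    set D := a * t + (1 - a) with hDdef
    have hu : (1 - a) / D ≤ 1 := by rw [div_le_one hD]; linarith
    have hv : t / D ≤ 1 := by
      rw [div_le_one hD]
      nlinarith
    have key₁ := hf.2 hx hM (sub_nonneg.2 hu) (div_nonneg hb hD.le) (by ring)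
    have key₂ := hf.2 hx hM (sub_nonneg.2 hv) (div_nonneg ht hD.le) (by ring)
    have hm : (1 - (1 - a) / D) • x + ((1 - a) / D) • M = a • x + (1 - a) • y := by
      have hD' := hD.ne'
      rw [hMdef]
      match_scalars <;> field_simp <;> rw [hDdef] <;> ring
    have hz : (1 - t / D) • x + (t / D) • M = (1 - t) • x + t • y := by
      have hD' := hD.ne'
      rw [hMdef]
      match_scalars <;> field_simp <;> rw [hDdef] <;> ring
    rw [hm] at key₁
    rw [hz] at key₂
    simp only [smul_eq_mul] at key₁ key₂
    have hsum : (1 - a) / D + a * (t / D) = 1 := by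
      field_simp
      rw [hDdef]
      ring
    have hfM : ((1 - a) / D + a * (t / D)) * (f M - f x) = f M - f x := by rw [hsum, one_mul]
    linarith [mul_le_mul_of_nonneg_left key₂ ha]

/-- The concavity gap of a concave function on the line is monotone under widening the pair. -/
theorem ConcaveOn.gap_le_gap {s : Set ℝ} {f : ℝ → ℝ} (hf : ConcaveOn ℝ s f) {p p' q' q : ℝ}
    (hp : p ∈ s) (hq : q ∈ s) (hpp' : p ≤ p') (hpq' : p' ≤ q') (hqq' : q' ≤ q)
    {a b : ℝ} (ha : 0 ≤ a) (hb : 0 ≤ b) (hab : a + b = 1) :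
    f (a * p' + b * q') - a * f p' - b * f q' ≤ f (a * p + b * q) - a * f p - b * f q := by
  have hp'_mem : p' ∈ segment ℝ p q := by
    rw [segment_eq_Icc (by linarith)]
    exact ⟨hpp', hpq'.trans hqq'⟩
  have hq'_mem : q' ∈ segment ℝ q p' := by
    rw [segment_symm, segment_eq_Icc (by linarith)]
    exact ⟨hpq', hqq'⟩
  have left := hf.gap_le_gap_of_mem_segment hp hq hp'_mem ha hb hab
  have right := hf.gap_le_gap_of_mem_segment hq (hf.1.segment_subset hp hq hp'_mem) hq'_mem
    hb ha (by linarith)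
  simp only [smul_eq_mul] at left right
  rw [add_comm (b * q'), add_comm (b * q)] at right
  linarith

theorem concaveOn_h2 : ConcaveOn ℝ (Set.Icc 0 1) h2 := by
  have h : h2 = Real.binEntropy := Real.binEntropy_eq_negMulLog_add_negMulLog_one_sub'.symm
  exact h ▸ Real.strictConcave_binEntropy.concaveOn

/-- The concavity gap of the binary entropy function is monotone under widening the
pair of points: for `0 ≤ p ≤ p' ≤ q' ≤ q ≤ 1` and `α ∈ [0,1]`, the gap at `(p', q')`
is at most the gap at `(p, q)`. -/
theorem h2_gap_monotone (p p' q' q α : ℝ)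
    (h0 : 0 ≤ p) (h1 : p ≤ p') (h2' : p' ≤ q') (h3 : q' ≤ q) (h4 : q ≤ 1)
    (hα0 : 0 ≤ α) (hα1 : α ≤ 1) :
    h2 (α * p' + (1 - α) * q') - α * h2 p' - (1 - α) * h2 q'
      ≤ h2 (α * p + (1 - α) * q) - α * h2 p - (1 - α) * h2 q :=
  concaveOn_h2.gap_le_gap ⟨h0, by linarith⟩ ⟨by linarith, h4⟩ h1 h2' h3 hα0 (sub_nonneg.2 hα1)
    (by ring)
end
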